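/- Let G be a (P_5, HVN)-free graph that contains an induced Y-5-wheel but no induced T-5-wheel. Then χ(G) ≤ ω(G) + 3. -/

import Mathlib

open SimpleGraph

/-- The paw: a triangle 0,1,2 plus vertex 3 adjacent only to 0. -/
def pawGraph : SimpleGraph (Fin 4) :=
  SimpleGraph.fromEdgeSet {s(0,1), s(0,2), s(1,2), s(0,3)}

/-- The HVN: a K₄ on 0,1,2,3 plus vertex 4 adjacent to exactly 0 and 1. -/
def hvnGraph : SimpleGraph (Fin 5) :=
  SimpleGraph.fromEdgeSet {s(0,1), s(0,2), s(0,3), s(1,2), s(1,3), s(2,3), s(4,0), s(4,1)}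

/-- The T-5-wheel: 5-cycle 0-1-2-3-4-0 plus vertex 5 adjacent to the three consecutive
vertices 4, 0, 1. -/
def t5WheelGraph : SimpleGraph (Fin 6) :=
  SimpleGraph.fromEdgeSet {s(0,1), s(1,2), s(2,3), s(3,4), s(4,0), s(5,4), s(5,0), s(5,1)}

/-- The Y-5-wheel: 5-cycle 0-1-2-3-4-0 plus vertex 5 adjacent to 0, 1, 3
(three non-consecutive vertices). -/
def y5WheelGraph : SimpleGraph (Fin 6) :=
  SimpleGraph.fromEdgeSet {s(0,1), s(1,2), s(2,3), s(3,4), s(4,0), s(5,0), s(5,1), s(5,3)}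

/-- `G` contains an induced copy of `H`: an injection preserving and reflecting adjacency. -/
def ContainsInduced {V W : Type*} (G : SimpleGraph V) (H : SimpleGraph W) : Prop :=
  ∃ f : W ↪ V, ∀ a b : W, H.Adj a b ↔ G.Adj (f a) (f b)

/-- `G` is `H`-free: no induced copy of `H`. -/
def InducedFree {V W : Type*} (G : SimpleGraph V) (H : SimpleGraph W) : Prop :=
  ¬ ContainsInduced G H

/-- `v` lists the vertices of an induced (chordless) 5-cycle of `G`, in order. -/
def IsInducedC5 {V : Type*} (G : SimpleGraph V) (v : ZMod 5 → V) : Prop :=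
  Function.Injective v ∧ ∀ i j : ZMod 5, G.Adj (v i) (v j) ↔ (j = i + 1 ∨ j = i - 1)

/-! ## Reachability inside a set, and patterns -/

/-- `b` can be reached from `a` by a walk staying inside `T`. -/
def Rch {V : Type*} (G : SimpleGraph V) (T : Set V) : V → V → Prop :=
  Relation.ReflTransGen (fun x y => x ∈ T ∧ y ∈ T ∧ G.Adj x y)

/-- The connected component of `x` in `T`. -/
def cmpt {V : Type*} (G : SimpleGraph V) (T : Set V) (x : V) : Set V := {y | Rch G T x y}

/-- `D` induces a connected subgraph. -/
def Conn {V : Type*} (G : SimpleGraph V) (D : Set V) : Prop :=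
  ∀ a ∈ D, ∀ b ∈ D, Rch G D a b

/-- `f` is a proper colouring on the set `S`. -/
def PropOn {V : Type*} (G : SimpleGraph V) (S : Set V) (f : V → ℕ) : Prop :=
  ∀ x ∈ S, ∀ y ∈ S, G.Adj x y → f x ≠ f y

/-- All cliques inside `S` have at most `k` vertices. -/
def CliqueLe {V : Type*} (G : SimpleGraph V) (S : Set V) (k : ℕ) : Prop :=
  ∀ q : Finset V, (↑q : Set V) ⊆ S → G.IsClique (↑q : Set V) → q.card ≤ k

/-- Triangle-free on `S`. -/
def TriFree {V : Type*} (G : SimpleGraph V) (S : Set V) : Prop :=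
  ∀ x ∈ S, ∀ y ∈ S, ∀ z ∈ S, G.Adj x y → G.Adj y z → G.Adj x z → False

/-- Explicit form of being `P₅`-free. -/
def P5F {V : Type*} (G : SimpleGraph V) : Prop :=
  ∀ a b c d e, G.Adj a b → G.Adj b c → G.Adj c d → G.Adj d e →
    ¬ G.Adj a c → ¬ G.Adj a d → ¬ G.Adj a e → ¬ G.Adj b d → ¬ G.Adj b e → ¬ G.Adj c e → False

/-- Explicit form of being HVN-free. -/
def HVNF {V : Type*} (G : SimpleGraph V) : Prop :=
  ∀ a b c d e, G.Adj a b → G.Adj a c → G.Adj a d → G.Adj b c → G.Adj b d → G.Adj c d →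
    G.Adj e a → G.Adj e b → ¬ G.Adj e c → ¬ G.Adj e d → False

/-- An induced 5-cycle. -/
def C5 {V : Type*} (G : SimpleGraph V) (a b c d e : V) : Prop :=
  G.Adj a b ∧ G.Adj b c ∧ G.Adj c d ∧ G.Adj d e ∧ G.Adj e a ∧
    ¬ G.Adj a c ∧ ¬ G.Adj b d ∧ ¬ G.Adj c e ∧ ¬ G.Adj d a ∧ ¬ G.Adj e b

/-- Explicit form of being T-5-wheel-free. -/
def T5F {V : Type*} (G : SimpleGraph V) : Prop :=
  ∀ a b c d e x, C5 G a b c d e → G.Adj x e → G.Adj x a → G.Adj x b →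
    ¬ G.Adj x c → ¬ G.Adj x d → False

section basics
variable {V : Type*} {G : SimpleGraph V}

theorem Rch.symm {T : Set V} {a b : V} (h : Rch G T a b) : Rch G T b a := by
  induction h with
  | refl => exact Relation.ReflTransGen.refl
  | tail _ h ih => exact Relation.ReflTransGen.head ⟨h.2.1, h.1, h.2.2.symm⟩ ih

theorem Rch.trans {T : Set V} {a b c : V} (h : Rch G T a b) (h' : Rch G T b c) : Rch G T a c :=
  Relation.ReflTransGen.trans h h'

theorem rch_adj {T : Set V} {a b : V} (ha : a ∈ T) (hb : b ∈ T) (h : G.Adj a b) :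
    Rch G T a b := Relation.ReflTransGen.single ⟨ha, hb, h⟩

theorem Rch.inv {T : Set V} {a b : V} (h : Rch G T a b) (P : V → Prop)
    (hP : ∀ x ∈ T, ∀ y ∈ T, G.Adj x y → P x → P y) (ha : P a) : P b := by
  induction h with
  | refl => exact ha
  | tail _ h ih => exact hP _ h.1 _ h.2.1 h.2.2 ih

theorem mem_cmpt_self {T : Set V} (x : V) : x ∈ cmpt G T x := Relation.ReflTransGen.refl

theorem cmpt_sub {T : Set V} {x : V} (hx : x ∈ T) : cmpt G T x ⊆ T := fun _ hy =>
  Rch.inv hy (fun z => z ∈ T) (fun _ _ _ h _ _ => h) hx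

theorem cmpt_eq {T : Set V} {x y : V} (h : Rch G T x y) : cmpt G T x = cmpt G T y := by
  ext z
  exact ⟨fun hz => h.symm.trans hz, fun hz => h.trans hz⟩

theorem cmpt_closed {T : Set V} {x y z : V} (hy : y ∈ cmpt G T x) (hyT : y ∈ T) (hz : z ∈ T)
    (h : G.Adj y z) : z ∈ cmpt G T x := Rch.trans hy (rch_adj hyT hz h)

theorem conn_cmpt {T : Set V} {x : V} (hx : x ∈ T) : Conn G (cmpt G T x) := by
  intro a ha b hb
  have hab : Rch G T a b := Rch.trans (Rch.symm ha) hb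
  refine (Rch.inv hab (fun z => z ∈ cmpt G T x ∧ Rch G (cmpt G T x) a z) ?_
    ⟨ha, Relation.ReflTransGen.refl⟩).2
  rintro p hp q hq hpq ⟨h1, h2⟩
  have h3 := cmpt_closed h1 hp hq hpq
  exact ⟨h3, h2.trans (rch_adj h1 h3 hpq)⟩

/-- Choose data once for every component. -/
theorem choose_comp {α : Type*} [Nonempty α] (R : Set V) (P : Set V → α → Prop)
    (h : ∀ x ∈ R, ∃ a, P (cmpt G R x) a) :
    ∃ f : V → α, (∀ x ∈ R, P (cmpt G R x) (f x)) ∧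
      ∀ x y, Rch G R x y → f x = f y := by
  classical
  let g : Set V → α := fun S => if h : ∃ a, P S a then h.choose else Classical.arbitrary α
  refine ⟨fun x => g (cmpt G R x), ?_, ?_⟩
  · intro x hx
    have := h x hx
    simp only [g, dif_pos this]
    exact this.choose_spec
  · intro x y hxy
    simp only [cmpt_eq hxy]

/-- Colour component by component. -/
theorem comp_color (T : Set V) (Q : V → ℕ → Prop)
    (h : ∀ x ∈ T, ∃ f : V → ℕ, PropOn G (cmpt G T x) f ∧ ∀ y ∈ cmpt G T x, Q y (f y)) :
    ∃ f : V → ℕ, PropOn G T f ∧ ∀ y ∈ T, Q y (f y) := by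
  obtain ⟨F, hF, hF'⟩ := choose_comp (G := G) T
    (fun S f => PropOn G S f ∧ ∀ y ∈ S, Q y (f y)) h
  refine ⟨fun y => F y y, ?_, fun y hy => (hF y hy).2 y (mem_cmpt_self y)⟩
  intro x hx y hy hxy
  have h1 := rch_adj hx hy hxy
  have h2 := (hF x hx).1 x (mem_cmpt_self x) y h1 hxy
  show F x x ≠ F y y
  rw [← hF' x y h1]
  exact h2

/-- A component of `R ⊆ F` has a neighbour in `F \ R`. -/
theorem exit_comp {F R : Set V} {x v : V} (hxv : Rch G F x v) (hx : x ∈ R) (hv : v ∉ R) :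
    ∃ d ∈ cmpt G R x, ∃ u ∈ F, u ∉ R ∧ G.Adj u d := by
  by_contra hcon
  push Not at hcon
  have : v ∈ cmpt G R x := by
    refine Rch.inv hxv (fun z => z ∈ cmpt G R x) ?_ (mem_cmpt_self x)
    intro p hp q hq hpq hpc
    by_cases hqR : q ∈ R
    · exact cmpt_closed hpc (cmpt_sub hx hpc) hqR hpq
    · exact absurd hpq.symm (hcon p hpc q hq hqR)
  exact hv (cmpt_sub hx this)

/-- The basic step in `P₅`-free graphs. -/
theorem step_all (hP : P5F G) {D : Set V} {x u w t t' : V} (hxu : G.Adj x u)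
    (hxD : ∀ d ∈ D, ¬ G.Adj x d) (hw : w ∈ D) (huw : G.Adj u w)
    (h : Rch G {d | d ∈ D ∧ ¬ G.Adj u d} t t') (hwt : G.Adj w t) : G.Adj w t' := by
  refine Rch.inv h (fun z => G.Adj w z) ?_ hwt
  rintro p ⟨hp, hp'⟩ q ⟨hq, hq'⟩ hpq hwp
  by_contra hwq
  exact hP x u w p q hxu huw hwp hpq (hxD _ hw) (hxD _ hp) (hxD _ hq) hp' hq' hwq

theorem step_ex (hP : P5F G) {D : Set V} {x u t d0 : V} (hD : Conn G D) (hxu : G.Adj x u)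
    (hxD : ∀ d ∈ D, ¬ G.Adj x d) (hd0 : d0 ∈ D) (hud0 : G.Adj u d0)
    (ht : t ∈ D) (hut : ¬ G.Adj u t) :
    ∃ w ∈ D, G.Adj u w ∧ ∀ t' ∈ cmpt G {d | d ∈ D ∧ ¬ G.Adj u d} t, G.Adj w t' := by
  obtain ⟨d, hd, w, hw, hwR, hwd⟩ := exit_comp (R := {d | d ∈ D ∧ ¬ G.Adj u d})
    (hD t ht d0 hd0) ⟨ht, hut⟩ (fun h => h.2 hud0)
  have huw : G.Adj u w := by
    by_contra h
    exact hwR ⟨hw, h⟩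
  exact ⟨w, hw, huw, fun t' ht' =>
    step_all hP hxu hxD hw huw (Rch.trans (Rch.symm hd) ht') hwd⟩

theorem propOn_mono {S S' : Set V} (h : S ⊆ S') {f : V → ℕ} (hf : PropOn G S' f) :
    PropOn G S f := fun x hx y hy => hf x (h hx) y (h hy)

theorem exists_maxClique [Finite V] (S : Set V) : ∃ q : Finset V, (↑q : Set V) ⊆ S ∧
    G.IsClique (↑q : Set V) ∧ CliqueLe G S q.card := by
  classical
  have := Fintype.ofFinite V
  obtain ⟨q, hq, hmax⟩ := Finset.exists_max_image
    (Finset.univ.filter (fun q : Finset V => (↑q : Set V) ⊆ S ∧ G.IsClique (↑q : Set V)))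
    Finset.card ⟨∅, by simp⟩
  simp only [Finset.mem_filter, Finset.mem_univ, true_and] at hq hmax
  exact ⟨q, hq.1, hq.2, fun q' h1 h2 => hmax q' ⟨h1, h2⟩⟩

/-! ## Triangle-free sets -/

/-- The canonical 3-colouring of a connected triangle-free set. -/
theorem tf_conn (hP : P5F G) {F : Set V} (hF : Conn G F) (ht : TriFree G F)
    (v : V) (hv : v ∈ F) : ∃ f : V → ℕ, PropOn G F f ∧ (∀ x ∈ F, f x < 3) ∧
      (∀ b ∈ F, ∀ c ∈ F, f b = 2 → f c = 0 → ¬ G.Adj b c →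
        ∃ x ∈ F, ∃ y ∈ F, G.Adj x b ∧ ¬ G.Adj x c ∧ G.Adj y c ∧ ¬ G.Adj y b) ∧
      (∀ a ∈ F, ∀ b ∈ F, G.Adj a b → f a = 0 → f b = 1 →
        ∃ p ∈ F, ∃ q ∈ F, ∃ r ∈ F, C5 G a p q r b) := by
  classical
  set R : Set V := {x | x ∈ F ∧ x ≠ v ∧ ¬ G.Adj v x} with hR
  have : Nonempty V := ⟨v⟩
  obtain ⟨u, hu, hu'⟩ := choose_comp (G := G) R
    (fun S u => u ∈ F ∧ G.Adj v u ∧ ∃ d ∈ S, G.Adj u d) (by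
      intro x hx
      obtain ⟨d, hd, u, huF, huR, hud⟩ := exit_comp (hF x hx.1 v hv) hx (fun h => h.2.1 rfl)
      have hdR := cmpt_sub hx hd
      refine ⟨u, huF, ?_, d, hd, hud⟩
      by_contra hvu
      refine huR ⟨huF, ?_, hvu⟩
      rintro rfl
      exact hdR.2.2 hud)
  have key : ∀ c ∈ R, ¬ G.Adj (u c) c → ∃ w ∈ R, Rch G R c w ∧ G.Adj (u c) w ∧ G.Adj w c ∧
      ∀ c' ∈ R, G.Adj c c' → ¬ G.Adj (u c) c' → False := by
    intro c hc huc
    obtain ⟨h1, h2, d0, hd0, h3⟩ := hu c hc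
    obtain ⟨w, hw, huw, hall⟩ := step_ex hP (conn_cmpt hc) h2
      (fun d hd => (cmpt_sub hc hd).2.2) hd0 h3 (mem_cmpt_self c) huc
    refine ⟨w, cmpt_sub hc hw, hw, huw, hall c (mem_cmpt_self c), ?_⟩
    intro c' hc' hcc' huc'
    have h5 : c' ∈ cmpt G R c := rch_adj hc hc' hcc'
    have h4 := hall c' (rch_adj ⟨mem_cmpt_self c, huc⟩ ⟨h5, huc'⟩ hcc')
    exact ht w (cmpt_sub hc hw).1 c hc.1 c' hc'.1 (hall c (mem_cmpt_self c)) hcc' h4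
  let f : V → ℕ := fun x => if x = v then 2 else if G.Adj v x then 1 else
    if G.Adj (u x) x then 2 else 0
  have f0 : ∀ x ∈ F, f x = 0 → x ∈ R ∧ ¬ G.Adj (u x) x := by
    intro x hx h
    simp only [f] at h
    split_ifs at h with h1 h2 h3
    exact ⟨⟨hx, h1, h2⟩, h3⟩
  have f1 : ∀ x ∈ F, f x = 1 → G.Adj v x := by
    intro x hx h
    simp only [f] at h
    by_contra h2
    rw [if_neg h2] at h
    split_ifs at h <;> omega
  have f2 : ∀ x ∈ F, f x = 2 → x = v ∨ x ∈ R ∧ G.Adj (u x) x := by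
    intro x hx h
    simp only [f] at h
    by_cases h1 : x = v
    · exact Or.inl h1
    · rw [if_neg h1] at h
      by_cases h2 : G.Adj v x
      · rw [if_pos h2] at h
        omega
      · rw [if_neg h2] at h
        by_cases h3 : G.Adj (u x) x
        · exact Or.inr ⟨⟨hx, h1, h2⟩, h3⟩
        · rw [if_neg h3] at h
          omega
  have f3 : ∀ x, f x < 3 := by
    intro x
    simp only [f]
    split_ifs <;> norm_num
  have huR : ∀ x ∈ R, ∀ y ∈ R, G.Adj x y → u x = u y := fun x hx y hy h =>
    hu' x y (rch_adj hx hy h)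
  refine ⟨f, ?_, fun x _ => f3 x, ?_, ?_⟩
  · intro x hx y hy hxy hfe
    have := f3 x
    interval_cases hfx : f x
    · obtain ⟨h1, h2⟩ := f0 x hx hfx
      obtain ⟨h3, h4⟩ := f0 y hy hfe.symm
      obtain ⟨w, _, _, _, _, h5⟩ := key x h1 h2
      refine h5 y h3 hxy ?_
      rw [huR x h1 y h3 hxy]; exact h4
    · exact ht v hv x hx y hy (f1 x hx hfx) hxy (f1 y hy hfe.symm)
    · rcases f2 x hx hfx with h1 | ⟨h1, h2⟩
      · rcases f2 y hy hfe.symm with h3 | ⟨h3, h4⟩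
        · subst h1; subst h3; exact G.loopless.irrefl _ hxy
        · subst h1; exact h3.2.2 hxy
      · rcases f2 y hy hfe.symm with h3 | ⟨h3, h4⟩
        · subst h3; exact h1.2.2 hxy.symm
        · rw [← huR x h1 y h3 hxy] at h4
          exact ht (u x) (hu x h1).1 x hx y hy h2 hxy h4
  · intro b hb c hc hfb hfc hbc
    obtain ⟨h1, h2⟩ := f0 c hc hfc
    obtain ⟨w, hwR, hcw, huw, hwc, _⟩ := key c h1 h2
    obtain ⟨huF, hvu, _⟩ := hu c h1
    rcases f2 b hb hfb with rfl | ⟨h3, h4⟩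
    · exact ⟨u c, huF, w, hwR.1, hvu.symm, h2, hwc, fun h => hwR.2.2 h.symm⟩
    · obtain ⟨hubF, hvub, _⟩ := hu b h3
      have hwb : ¬ G.Adj w b := by
        intro hwb
        have h5 : u b = u c := by
          rw [← huR w hwR b h3 hwb, ← hu' c w hcw]
        rw [h5] at h4
        exact ht (u c) huF w hwR.1 b hb huw hwb h4
      by_cases h6 : G.Adj (u c) b
      · exact ⟨u c, huF, w, hwR.1, h6, h2, hwc, hwb⟩
      by_cases h7 : G.Adj (u b) c
      · exfalso
        refine hP b (u b) c w (u c) h4.symm h7 hwc.symm huw.symm hbc (fun h => hwb h.symm)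
          (fun h => h6 h.symm) ?_ ?_ (fun h => h2 h.symm)
        · intro h8
          exact ht (u b) hubF c hc w hwR.1 h7 hwc.symm h8
        · intro h8
          exact ht v hv (u b) hubF (u c) huF hvub h8 hvu
      · exact ⟨u b, hubF, w, hwR.1, h4, h7, hwc, hwb⟩
  · intro a ha b hb hab hfa hfb
    obtain ⟨h1, h2⟩ := f0 a ha hfa
    obtain ⟨w, hwR, hcw, huw, hwa, _⟩ := key a h1 h2
    obtain ⟨huF, hvu, _⟩ := hu a h1
    have hvb := f1 b hb hfb
    refine ⟨w, hwR.1, u a, huF, v, hv, hwa.symm, huw.symm, hvu.symm, hvb, hab.symm,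
      fun h => h2 h.symm, fun h => hwR.2.2 h.symm, ?_, h1.2.2, ?_⟩
    · intro h
      exact ht v hv (u a) huF b hb hvu h hvb
    · intro h
      exact ht a ha w hwR.1 b hb hwa.symm h.symm hab

/-- Triangle-free sets have a good 3-colouring. -/
theorem tf_color (hP : P5F G) {S : Set V} (ht : TriFree G S) :
    ∃ f : V → ℕ, PropOn G S f ∧ (∀ x ∈ S, f x < 3) ∧
      (∀ b ∈ S, ∀ c ∈ S, f b = 2 → f c = 0 → ¬ G.Adj b c →
        ∃ x ∈ S, ∃ y ∈ S, G.Adj x b ∧ ¬ G.Adj x c ∧ G.Adj y c ∧ ¬ G.Adj y b) := by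
  classical
  obtain ⟨F, hF, hF'⟩ := choose_comp (G := G) S
    (fun F f => (PropOn G F f ∧ (∀ x ∈ F, f x < 3) ∧
      (∀ b ∈ F, ∀ c ∈ F, f b = 2 → f c = 0 → ¬ G.Adj b c →
        ∃ x ∈ F, ∃ y ∈ F, G.Adj x b ∧ ¬ G.Adj x c ∧ G.Adj y c ∧ ¬ G.Adj y b))
      ∧ ∀ x ∈ F, (∀ y ∈ F, ¬ G.Adj x y) → f x = 1) (by
    intro x hx
    by_cases hs : ∃ y ∈ S, G.Adj x y
    · obtain ⟨f, h1, h2, h3, _⟩ := tf_conn hP (conn_cmpt hx)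
        (fun a ha b hb c hc => ht a (cmpt_sub hx ha) b (cmpt_sub hx hb) c (cmpt_sub hx hc))
        x (mem_cmpt_self x)
      refine ⟨f, ⟨h1, h2, h3⟩, ?_⟩
      intro y hy hiso
      exfalso
      have h4 : Rch G S y x := Rch.symm hy
      have h5 : x = y := by
        refine Rch.inv h4 (fun z => z = y) ?_ rfl
        rintro p hp q hq hpq rfl
        exact absurd hpq (hiso q (cmpt_closed hy hp hq hpq))
      subst h5
      obtain ⟨y, hyS, hxy⟩ := hs
      exact hiso y (rch_adj hx hyS hxy) hxy
    · push Not at hs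
      refine ⟨fun _ => 1, ⟨?_, by simp, by simp⟩, by simp⟩
      intro p hp q hq hpq
      exfalso
      have h5 : p = x := by
        refine Rch.inv hp (fun z => z = x) ?_ rfl
        rintro p' hp' q' hq' hpq' rfl
        exact absurd hpq' (hs q' hq')
      subst h5
      exact hs q (cmpt_sub hx hq) hpq)
  refine ⟨fun y => F y y, ?_, fun x hx => (hF x hx).1.2.1 x (mem_cmpt_self x), ?_⟩
  · intro x hx y hy hxy
    have h1 := rch_adj hx hy hxy
    have h2 := (hF x hx).1.1 x (mem_cmpt_self x) y h1 hxy
    show F x x ≠ F y y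
    rw [← hF' x y h1]
    exact h2
  · intro b hb c hc hfb hfc hbc
    have hfb : F b b = 2 := hfb
    have hfc : F c c = 0 := hfc
    by_cases hr : Rch G S b c
    · rw [← hF' b c hr] at hfc
      obtain ⟨x, hx, y, hy, h⟩ := (hF b hb).1.2.2 b (mem_cmpt_self b) c hr hfb hfc hbc
      exact ⟨x, cmpt_sub hb hx, y, cmpt_sub hb hy, h⟩
    · have hb1 : ∃ x ∈ cmpt G S b, G.Adj b x := by
        by_contra h
        push Not at h
        have := (hF b hb).2 b (mem_cmpt_self b) h
        omega
      have hc1 : ∃ x ∈ cmpt G S c, G.Adj c x := by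
        by_contra h
        push Not at h
        have := (hF c hc).2 c (mem_cmpt_self c) h
        omega
      obtain ⟨x, hx, hbx⟩ := hb1
      obtain ⟨y, hy, hcy⟩ := hc1
      refine ⟨x, cmpt_sub hb hx, y, cmpt_sub hc hy, hbx.symm, ?_, hcy.symm, ?_⟩
      · intro h
        exact hr (Rch.trans hx (rch_adj (cmpt_sub hb hx) hc h))
      · intro h
        exact hr (Rch.symm (Rch.trans hy (rch_adj (cmpt_sub hc hy) hb h)))

/-- Triangle-free, `C₅`-free sets are bipartite. -/
theorem tf_bip (hP : P5F G) {S : Set V} (ht : TriFree G S)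
    (h5 : ∀ a ∈ S, ∀ b ∈ S, ∀ c ∈ S, ∀ d ∈ S, ∀ e ∈ S, ¬ C5 G a b c d e) :
    ∃ f : V → ℕ, PropOn G S f ∧ ∀ x ∈ S, f x < 2 := by
  refine comp_color S (fun _ k => k < 2) ?_
  intro x hx
  obtain ⟨f, h1, h2, h3, h4⟩ := tf_conn hP (conn_cmpt hx)
        (fun a ha b hb c hc => ht a (cmpt_sub hx ha) b (cmpt_sub hx hb) c (cmpt_sub hx hc))
        x (mem_cmpt_self x)
  have hh : ∀ a ∈ cmpt G S x, ∀ b ∈ cmpt G S x, G.Adj a b → f a = 0 → f b = 1 → False := by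
    intro a ha b hb hab hfa hfb
    obtain ⟨p, hp, q, hq, r, hr, hc⟩ := h4 a ha b hb hab hfa hfb
    exact h5 a (cmpt_sub hx ha) p (cmpt_sub hx hp) q (cmpt_sub hx hq) r (cmpt_sub hx hr) b
      (cmpt_sub hx hb) hc
  refine ⟨fun y => f y - 1, ?_, ?_⟩
  · intro a ha b hb hab he
    have e1 := h1 a ha b hb hab
    have e2 := h2 a ha
    have e3 := h2 b hb
    have e4 : ¬ (f a = 0 ∧ f b = 1) := fun h => hh a ha b hb hab h.1 h.2
    have e5 : ¬ (f b = 0 ∧ f a = 1) := fun h => hh b hb a ha hab.symm h.1 h.2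
    have he : f a - 1 = f b - 1 := he
    omega
  · intro y hy
    have := h2 y hy
    simp only
    omega

end basics

/-! ## Neighbourhoods in HVN-free graphs -/

/-- Non-adjacency is transitive on `Q`. -/
def NonTrans {V : Type*} (G : SimpleGraph V) (Q : Set V) : Prop :=
  ∀ x ∈ Q, ∀ y ∈ Q, ∀ z ∈ Q, ¬ G.Adj x y → ¬ G.Adj y z → ¬ G.Adj x z

section paws
variable {V : Type*} {G : SimpleGraph V}

/-- Connected paw-free graphs are triangle-free or complete multipartite. -/
theorem paw_dichotomy (hH : HVNF G) {Q : Set V} {p : V} (hQ : Conn G Q)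
    (hp : ∀ x ∈ Q, G.Adj p x) : TriFree G Q ∨ NonTrans G Q := by
  by_cases htf : TriFree G Q
  · exact Or.inl htf
  right
  have pw : ∀ a ∈ Q, ∀ b ∈ Q, ∀ c ∈ Q, ∀ e ∈ Q, G.Adj a b → G.Adj a c → G.Adj b c →
      G.Adj e a → G.Adj e b ∨ G.Adj e c := by
    intro a ha b hb c hc e he hab hac hbc hea
    by_contra h
    push Not at h
    exact hH p a b c e (hp a ha) (hp b hb) (hp c hc) hab hac hbc (hp e he).symm hea h.1 h.2
  have tri : ∀ x ∈ Q, ∃ y ∈ Q, ∃ z ∈ Q, G.Adj x y ∧ G.Adj x z ∧ G.Adj y z := by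
    unfold TriFree at htf
    push Not at htf
    obtain ⟨a, ha, b, hb, c, hc, hab, hbc, hac, _⟩ := htf
    intro x hx
    refine Rch.inv (hQ a ha x hx)
      (fun x => ∃ y ∈ Q, ∃ z ∈ Q, G.Adj x y ∧ G.Adj x z ∧ G.Adj y z) ?_
      ⟨b, hb, c, hc, hab, hac, hbc⟩
    rintro u hu v hv huv ⟨y, hy, z, hz, h1, h2, h3⟩
    rcases pw u hu y hy z hz v hv h1 h2 h3 huv.symm with h | h
    · exact ⟨u, hu, y, hy, huv.symm, h, h1⟩
    · exact ⟨u, hu, z, hz, huv.symm, h, h2⟩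
  have edge : ∀ y ∈ Q, ∀ z ∈ Q, G.Adj y z → ∃ t ∈ Q, G.Adj y t ∧ G.Adj z t := by
    intro y hy z hz hyz
    obtain ⟨a, ha, b, hb, h1, h2, h3⟩ := tri y hy
    rcases pw y hy a ha b hb z hz h1 h2 h3 hyz.symm with h | h
    · exact ⟨a, ha, h1, h⟩
    · exact ⟨b, hb, h2, h⟩
  have prop : ∀ y ∈ Q, ∀ z ∈ Q, G.Adj y z → ∀ x ∈ Q, ∀ x' ∈ Q, G.Adj x x' → G.Adj x y →
      G.Adj x' y ∨ G.Adj x' z := by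
    intro y hy z hz hyz x hx x' hx' hxx hxy
    obtain ⟨t, ht, hxt, hyt⟩ := edge x hx y hy hxy
    rcases pw x hx y hy t ht x' hx' hxy hxt hyt hxx.symm with h | h
    · exact Or.inl h
    rcases pw y hy x hx t ht z hz hxy.symm hyt hxt hyz.symm with h1 | h1
    · exact pw x hx y hy z hz x' hx' hxy h1.symm hyz hxx.symm
    · exact pw t ht y hy z hz x' hx' hyt.symm h1.symm hyz h
  have dom : ∀ y ∈ Q, ∀ z ∈ Q, G.Adj y z → ∀ x ∈ Q, G.Adj x y ∨ G.Adj x z := by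
    intro y hy z hz hyz x hx
    refine Rch.inv (hQ y hy x hx) (fun x => G.Adj x y ∨ G.Adj x z) ?_ (Or.inr hyz)
    rintro a ha b hb hab (h | h)
    · exact prop y hy z hz hyz a ha b hb hab h
    · exact (prop z hz y hy hyz.symm a ha b hb hab h).symm
  intro x hx y hy z hz hxy hyz hxz
  rcases dom x hx z hz hxz y hy with h | h
  · exact hxy h.symm
  · exact hyz h

theorem finset_index (q : Finset V) : ∃ e : V → ℕ,
    (∀ x ∈ q, ∀ y ∈ q, e x = e y → x = y) ∧ ∀ x ∈ q, e x < q.card := by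
  classical
  refine ⟨fun x => if h : x ∈ q then (q.equivFin ⟨x, h⟩ : ℕ) else 0, ?_, ?_⟩
  · intro x hx y hy h
    simp only [dif_pos hx, dif_pos hy] at h
    have := q.equivFin.injective (Fin.ext h)
    exact congrArg Subtype.val this
  · intro x hx
    simp only [dif_pos hx]
    exact Fin.is_lt _

/-- A maximal clique dominates everything. -/
theorem maxClique_nonadj [Finite V] {Q : Set V} {q : Finset V} (hq : (↑q : Set V) ⊆ Q)
    (hc : G.IsClique (↑q : Set V)) (hm : CliqueLe G Q q.card) {x : V} (hx : x ∈ Q) :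
    ∃ k ∈ q, ¬ G.Adj x k := by
  classical
  by_contra hcon
  push Not at hcon
  have hxq : x ∉ q := fun h => G.loopless.irrefl x (hcon x h)
  have h1 := hm (insert x q) (by
    intro y hy
    rw [Finset.mem_coe, Finset.mem_insert] at hy
    rcases hy with rfl | h
    · exact hx
    · exact hq h) (by
    rw [Finset.coe_insert]
    exact hc.insert (fun b hb _ => hcon b hb))
  rw [Finset.card_insert_of_notMem hxq] at h1
  omega

/-- Colouring complete multipartite sets. -/
theorem cm_color [Finite V] {Q : Set V} (hN : NonTrans G Q) : ∃ (f : V → ℕ) (q : Finset V),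
    PropOn G Q f ∧ (↑q : Set V) ⊆ Q ∧ G.IsClique (↑q : Set V) ∧ (∀ x ∈ Q, f x < q.card) ∧
      ∀ x ∈ Q, ∀ y ∈ Q, ¬ G.Adj x y → f x = f y := by
  classical
  obtain ⟨q, hq, hc, hm⟩ := exists_maxClique (G := G) Q
  obtain ⟨e, he, he'⟩ := finset_index q
  have h1 : ∀ x, ∃ k, x ∈ Q → k ∈ q ∧ ¬ G.Adj x k := by
    intro x
    by_cases hx : x ∈ Q
    · obtain ⟨k, hk, h⟩ := maxClique_nonadj hq hc hm hx
      exact ⟨k, fun _ => ⟨hk, h⟩⟩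
    · exact ⟨x, fun h => absurd h hx⟩
  choose k hk using h1
  refine ⟨fun x => e (k x), q, ?_, hq, hc, fun x hx => he' _ (hk x hx).1, ?_⟩
  · intro x hx y hy hxy heq
    have h2 := he _ (hk x hx).1 _ (hk y hy).1 heq
    refine hN x hx (k x) (hq (hk x hx).1) y hy (hk x hx).2 ?_ hxy
    rw [h2]
    exact fun h => (hk y hy).2 h.symm
  · intro x hx y hy hxy
    have h2 : ¬ G.Adj x (k y) := hN x hx y hy _ (hq (hk y hy).1) hxy (hk y hy).2
    have h3 : ¬ G.Adj (k x) (k y) :=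
      hN _ (hq (hk x hx).1) x hx _ (hq (hk y hy).1) (fun h => (hk x hx).2 h.symm) h2
    have h4 : k x = k y := by
      by_contra hne
      exact h3 (hc (hk x hx).1 (hk y hy).1 hne)
    simp only [h4]

/-- Colouring a connected subset of a neighbourhood. -/
theorem paw_color [Finite V] (hP : P5F G) (hH : HVNF G) {Q : Set V} {p : V} {k : ℕ}
    (hQ : Conn G Q) (hp : ∀ x ∈ Q, G.Adj p x) (hk : CliqueLe G Q k) :
    ∃ f : V → ℕ, PropOn G Q f ∧ ((∀ x ∈ Q, f x < 3) ∨
      ((∀ x ∈ Q, f x < k) ∧ ∀ x ∈ Q, ∀ y ∈ Q, ¬ G.Adj x y → f x = f y)) := by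
  rcases paw_dichotomy hH hQ hp with h | h
  · obtain ⟨f, h1, h2, _⟩ := tf_color hP h
    exact ⟨f, h1, Or.inl h2⟩
  · obtain ⟨f, q, h1, h2, h3, h4, h5⟩ := cm_color h
    exact ⟨f, h1, Or.inr ⟨fun x hx => lt_of_lt_of_le (h4 x hx) (hk q h2 h3), h5⟩⟩

/-- Colouring a connected subset of a neighbourhood with `ω + 1` colours. -/
theorem paw_color' [Finite V] (hP : P5F G) (hH : HVNF G) {Q : Set V} {p : V}
    (hQ : Conn G Q) (hp : ∀ x ∈ Q, G.Adj p x) :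
    ∃ (f : V → ℕ) (q : Finset V), PropOn G Q f ∧ (↑q : Set V) ⊆ Q ∧
      G.IsClique (↑q : Set V) ∧ ∀ x ∈ Q, f x ≤ q.card := by
  classical
  rcases paw_dichotomy hH hQ hp with h | h
  · obtain ⟨f, h1, h2, _⟩ := tf_color hP h
    by_cases he : ∃ x ∈ Q, ∃ y ∈ Q, G.Adj x y
    · obtain ⟨x, hx, y, hy, hxy⟩ := he
      refine ⟨f, {x, y}, h1, ?_, ?_, ?_⟩
      · intro z hz
        simp only [Finset.coe_insert, Finset.coe_singleton, Set.mem_insert_iff,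
          Set.mem_singleton_iff] at hz
        rcases hz with rfl | rfl <;> assumption
      · intro a ha b hb hab
        simp only [Finset.coe_insert, Finset.coe_singleton, Set.mem_insert_iff,
          Set.mem_singleton_iff] at ha hb
        rcases ha with rfl | rfl <;> rcases hb with rfl | rfl
        · exact absurd rfl hab
        · exact hxy
        · exact hxy.symm
        · exact absurd rfl hab
      · intro z hz
        rw [Finset.card_pair hxy.ne]
        have := h2 z hz
        omega
    · push Not at he
      exact ⟨fun _ => 0, ∅, fun x hx y hy hxy => absurd hxy (he x hx y hy), by simp, by simp,
        by simp⟩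
  · obtain ⟨f, q, h1, h2, h3, h4, h5⟩ := cm_color h
    exact ⟨f, q, h1, h2, h3, fun x hx => (h4 x hx).le⟩

end paws

/-! ## A colouring lemma for components attached to a vertex -/
section caseI
variable {V : Type*} {G : SimpleGraph V}

theorem rename_cols (n k N : ℕ) (P : Finset ℕ) (hP : P.card ≤ k) (hN : n + k ≤ N) :
    ∃ φ : ℕ → ℕ, (∀ a < n, ∀ b < n, φ a = φ b → a = b) ∧ (∀ a < n, φ a < N) ∧
      ∀ a < n, φ a ∉ P := by
  classical
  set s := Finset.range N \ P with hs
  have hcard : n ≤ s.card := by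
    have := Finset.le_card_sdiff P (Finset.range N)
    rw [Finset.card_range, ← hs] at this
    omega
  have hmem : ∀ a (h : a < n), (s.equivFin.symm ⟨a, lt_of_lt_of_le h hcard⟩ : ℕ) ∈ s :=
    fun a h => (s.equivFin.symm _).2
  refine ⟨fun a => if h : a < n then (s.equivFin.symm ⟨a, lt_of_lt_of_le h hcard⟩ : ℕ) else 0,
    ?_, ?_, ?_⟩
  · intro a ha b hb h
    simp only [dif_pos ha, dif_pos hb] at h
    have := s.equivFin.symm.injective (Subtype.ext h)
    simpa using this
  · intro a ha
    simp only [dif_pos ha]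
    exact Finset.mem_range.1 (Finset.mem_sdiff.1 (hmem a ha)).1
  · intro a ha
    simp only [dif_pos ha]
    exact (Finset.mem_sdiff.1 (hmem a ha)).2

theorem cliqueLe_nbr {U Q : Set V} {p : V} {n : ℕ} (hU : CliqueLe G U n) (hQ : Q ⊆ U)
    (hpU : p ∈ U) (hp : ∀ x ∈ Q, G.Adj p x) : CliqueLe G Q (n - 1) := by
  classical
  intro q hq hc
  have hpq : p ∉ q := fun h => G.loopless.irrefl p (hp p (hq h))
  have h1 := hU (insert p q) (by
    intro y hy
    rw [Finset.mem_coe, Finset.mem_insert] at hy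
    rcases hy with rfl | h
    · exact hpU
    · exact hQ (hq h)) (by
    rw [Finset.coe_insert]
    exact hc.insert (fun b hb _ => hp b (hq hb)))
  rw [Finset.card_insert_of_notMem hpq] at h1
  omega

theorem iso_cmpt {T : Set V} {x y : V} (h : ∀ z ∈ T, ¬ G.Adj x z) (hy : y ∈ cmpt G T x) :
    y = x := by
  refine Rch.inv hy (fun z => z = x) ?_ rfl
  rintro p hp q hq hpq rfl
  exact absurd hpq (h q hq)

theorem caseI_comp [Finite V] (hP : P5F G) (hH : HVNF G) {U D : Set V} {n : ℕ} (hn : 4 ≤ n)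
    {x0 m d0 : V} (hU : CliqueLe G U n) (hDU : D ⊆ U) (hD : Conn G D) (hmU : m ∈ U)
    (hxm : G.Adj x0 m) (hxD : ∀ d ∈ D, ¬ G.Adj x0 d) (hd0 : d0 ∈ D) (hmd0 : G.Adj m d0) :
    ∃ f : V → ℕ, PropOn G D f ∧ ∀ y ∈ D, f y < n + 2 := by
  classical
  set S : Set V := {d | d ∈ D ∧ G.Adj m d} with hS
  set T : Set V := {d | d ∈ D ∧ ¬ G.Adj m d} with hT
  -- colouring of S
  obtain ⟨F, hF, hF'⟩ := choose_comp (G := G) S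
    (fun Q f => PropOn G Q f ∧ (∀ x ∈ Q, f x < n - 1) ∧
      (∀ x ∈ Q, (∀ y ∈ Q, ¬ G.Adj x y) → f x = 0) ∧
      ((∀ x ∈ Q, f x < 3) ∨ (∀ x ∈ Q, ∀ y ∈ Q, ¬ G.Adj x y → f x = f y))) (by
    intro x hx
    have hsub : cmpt G S x ⊆ S := cmpt_sub hx
    by_cases hs : ∃ y ∈ S, G.Adj x y
    · obtain ⟨f, h1, h2⟩ := paw_color hP hH (conn_cmpt hx) (fun y hy => (hsub hy).2)
        (cliqueLe_nbr hU (fun y hy => hDU (hsub hy).1) hmU (fun y hy => (hsub hy).2))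
      refine ⟨f, h1, ?_, ?_, ?_⟩
      · intro y hy
        rcases h2 with h2 | h2
        · have := h2 y hy
          omega
        · exact h2.1 y hy
      · intro y hy hiso
        exfalso
        have h4 : Rch G S y x := Rch.symm hy
        have hy' : ∀ z ∈ S, ¬ G.Adj y z := fun z hz hyz =>
          hiso z (cmpt_closed hy (hsub hy) hz hyz) hyz
        have h5 := iso_cmpt hy' h4
        subst h5
        obtain ⟨z, hz, hxz⟩ := hs
        exact hy' z hz hxz
      · rcases h2 with h2 | h2
        · exact Or.inl h2
        · exact Or.inr h2.2
    · push Not at hs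
      refine ⟨fun _ => 0, ?_, fun _ _ => (by omega : 0 < n - 1), fun _ _ _ => rfl,
        Or.inl fun _ _ => by norm_num⟩
      intro p hp q hq hpq
      rw [iso_cmpt hs hp] at hpq
      exact absurd hpq (hs q (hsub hq)))
  obtain ⟨g, hg⟩ : ∃ g : V → ℕ, ∀ y, g y = F y y := ⟨_, fun _ => rfl⟩
  have hgr : ∀ x y, Rch G S x y → g y = F x y := by
    intro x y h
    rw [hg, hF' x y h]
  have hgS : PropOn G S g := by
    intro x hx y hy hxy
    have h1 := rch_adj hx hy hxy
    rw [hg x, hgr x y h1]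
    exact (hF x hx).1 x (mem_cmpt_self x) y h1 hxy
  have hgn : ∀ x ∈ S, g x < n - 1 := fun x hx => by
    rw [hg]; exact (hF x hx).2.1 x (mem_cmpt_self x)
  have hg0 : ∀ x ∈ S, (∀ y ∈ S, ¬ G.Adj x y) → g x = 0 := fun x hx h => by
    rw [hg]
    exact (hF x hx).2.2.1 x (mem_cmpt_self x) (fun y hy => h y (cmpt_sub hx hy))
  -- colouring of T
  obtain ⟨hh, hh1, hh2⟩ := comp_color (G := G) T
    (fun t c => c < n + 2 ∧ ∀ w ∈ S, G.Adj w t → g w ≠ c) (by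
    intro t ht
    have hsub : cmpt G T t ⊆ T := cmpt_sub ht
    by_cases hs : ∃ y ∈ T, G.Adj t y
    · obtain ⟨t', ht', htt'⟩ := hs
      obtain ⟨w, hw, hmw, hwE⟩ := step_ex hP hD hxm hxD hd0 hmd0 ht.1 ht.2
      change ∀ t' ∈ cmpt G T t, G.Adj w t' at hwE
      have hall : ∀ w ∈ S, ∀ a ∈ cmpt G T t, G.Adj w a → ∀ b ∈ cmpt G T t, G.Adj w b := by
        intro w hw a ha hwa b hb
        exact step_all hP hxm hxD hw.1 hw.2 (Rch.trans (Rch.symm ha) hb) hwa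
      have htc : t ∈ cmpt G T t := mem_cmpt_self t
      have ht'c : t' ∈ cmpt G T t := rch_adj ht ht' htt'
      have hind : ∀ w ∈ S, ∀ w' ∈ S, G.Adj w t → G.Adj w' t → ¬ G.Adj w w' := by
        intro w hw w' hw' h1 h2 h3
        exact hH w w' t t' m h3 h1 (hall w hw t htc h1 t' ht'c) h2
          (hall w' hw' t htc h2 t' ht'c) htt' hw.2 hw'.2 ht.2 ht'.2
      obtain ⟨P, hPc, hPg⟩ : ∃ P : Finset ℕ, P.card ≤ 3 ∧ ∀ w ∈ S, G.Adj w t → g w ∈ P := by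
        by_cases hni : ∃ w ∈ S, G.Adj w t ∧ ∃ x ∈ S, G.Adj x w
        · obtain ⟨w, hw, hwt, x, hx, hxw⟩ := hni
          have hsame : ∀ w' ∈ S, G.Adj w' t → g w' = 0 ∨ w' ∈ cmpt G S w := by
            intro w' hw' hw't
            by_cases hiso : ∀ y ∈ S, ¬ G.Adj w' y
            · exact Or.inl (hg0 w' hw' hiso)
            right
            push Not at hiso
            obtain ⟨y, hy, hw'y⟩ := hiso
            by_contra hnc
            have hxc : x ∈ cmpt G S w := rch_adj hw hx hxw.symm
            have hyn : y ∉ cmpt G S w := fun h => hnc (cmpt_closed h hy hw' hw'y.symm)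
            exact hP x w t w' y hxw hwt hw't.symm hw'y
              (fun h => hind x hx w hw h hwt hxw)
              (fun h => hnc (cmpt_closed hxc hx hw' h))
              (fun h => hyn (cmpt_closed hxc hx hy h))
              (hind w hw w' hw' hwt hw't)
              (fun h => hyn (rch_adj hw hy h))
              (fun h => hind y hy w' hw' h.symm hw't hw'y.symm)
          rcases (hF w hw).2.2.2 with h3 | h3
          · refine ⟨{0, 1, 2}, by simp, ?_⟩
            intro w' hw' hw't
            have : g w' < 3 := by
              rcases hsame w' hw' hw't with h | h
              · omega
              · rw [hgr w w' h]; exact h3 w' h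
            simp only [Finset.mem_insert, Finset.mem_singleton]
            omega
          · refine ⟨{0, g w}, (Finset.card_le_two).trans (by norm_num), ?_⟩
            intro w' hw' hw't
            simp only [Finset.mem_insert, Finset.mem_singleton]
            rcases hsame w' hw' hw't with h | h
            · exact Or.inl h
            · right
              rw [hgr w w' h, hg w]
              exact h3 w' h w (mem_cmpt_self w) (hind w' hw' w hw hw't hwt)
        · push Not at hni
          refine ⟨{0}, by simp, ?_⟩
          intro w hw hwt
          rw [Finset.mem_singleton]
          exact hg0 w hw (fun y hy h => hni w hw hwt y hy h.symm)
      obtain ⟨f, h1, h2⟩ := paw_color hP hH (conn_cmpt ht) hwE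
        (cliqueLe_nbr hU (fun y hy => hDU (hsub hy).1) (hDU hw) hwE)
      have h3 : ∀ y ∈ cmpt G T t, f y < n - 1 := by
        intro y hy
        rcases h2 with h2 | h2
        · have := h2 y hy
          omega
        · exact h2.1 y hy
      obtain ⟨φ, p1, p2, p3⟩ := rename_cols (n - 1) 3 (n + 2) P hPc (by omega)
      refine ⟨fun y => φ (f y), ?_, ?_⟩
      · intro a ha b hb hab hc
        exact h1 a ha b hb hab (p1 _ (h3 a ha) _ (h3 b hb) hc)
      · intro y hy
        refine ⟨p2 _ (h3 y hy), ?_⟩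
        intro w hw hwy he
        have := hPg w hw (hall w hw y hy hwy t htc)
        rw [he] at this
        exact p3 _ (h3 y hy) this
    · push Not at hs
      refine ⟨fun _ => n + 1, ?_, ?_⟩
      · intro p hp q hq hpq
        rw [iso_cmpt hs hp] at hpq
        exact absurd hpq (hs q (hsub hq))
      · intro y hy
        refine ⟨(by omega : n + 1 < n + 2), ?_⟩
        intro w hw _
        show g w ≠ n + 1
        have := hgn w hw
        omega)
  refine ⟨fun x => if G.Adj m x then g x else hh x, ?_, ?_⟩
  · intro x hx y hy hxy
    by_cases h1 : G.Adj m x <;> by_cases h2 : G.Adj m y <;> simp only [h1, h2, if_true, if_false]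
    · exact hgS x ⟨hx, h1⟩ y ⟨hy, h2⟩ hxy
    · exact (hh2 y ⟨hy, h2⟩).2 x ⟨hx, h1⟩ hxy
    · exact ((hh2 x ⟨hx, h1⟩).2 y ⟨hy, h2⟩ hxy.symm).symm
    · exact hh1 x ⟨hx, h1⟩ y ⟨hy, h2⟩ hxy
  · intro y hy
    by_cases h1 : G.Adj m y <;> simp only [h1, if_true, if_false]
    · have := hgn y ⟨hy, h1⟩
      omega
    · exact (hh2 y ⟨hy, h1⟩).1

end caseI

/-! ## Components with a clique on at least four vertices -/

/-- The hypotheses on a component whose maximum clique `K` has at least four vertices. -/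
structure Big {V : Type*} (G : SimpleGraph V) (U : Set V) (K : Finset V) : Prop where
  p5 : P5F G
  hvn : HVNF G
  conn : Conn G U
  sub : (↑K : Set V) ⊆ U
  clique : G.IsClique (↑K : Set V)
  max : CliqueLe G U K.card
  four : 4 ≤ K.card

/-- The part of `k`: vertices adjacent to exactly `K \ {k}`. -/
def Mp {V : Type*} (G : SimpleGraph V) (U : Set V) (K : Finset V) (k x : V) : Prop :=
  x ∈ U ∧ ∀ m ∈ K, (G.Adj x m ↔ m ≠ k)

/-- The vertices outside all parts. -/
def Rr {V : Type*} (G : SimpleGraph V) (U : Set V) (K : Finset V) (x : V) : Prop :=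
  x ∈ U ∧ ∀ k ∈ K, ¬ Mp G U K k x

/-- The vertices outside with a neighbour in the part of `k`. -/
def Bb {V : Type*} (G : SimpleGraph V) (U : Set V) (K : Finset V) (k x : V) : Prop :=
  k ∈ K ∧ Rr G U K x ∧ ∃ m, Mp G U K k m ∧ G.Adj m x

/-- The vertices outside without neighbours in parts. -/
def Aa {V : Type*} (G : SimpleGraph V) (U : Set V) (K : Finset V) (x : V) : Prop :=
  Rr G U K x ∧ ∀ k ∈ K, ∀ m, Mp G U K k m → ¬ G.Adj m x

namespace Big
variable {V : Type*} {G : SimpleGraph V} {U : Set V} {K : Finset V}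

theorem pick (h : Big G U K) (a b c : V) : ∃ d ∈ K, d ≠ a ∧ d ≠ b ∧ d ≠ c := by
  classical
  have h1 : ({a, b, c} : Finset V).card < K.card :=
    lt_of_le_of_lt Finset.card_le_three (by have := h.four; omega)
  obtain ⟨d, hd, hd'⟩ := Finset.exists_mem_notMem_of_card_lt_card h1
  simp only [Finset.mem_insert, Finset.mem_singleton, not_or] at hd'
  exact ⟨d, hd, hd'⟩

theorem mp_self (h : Big G U K) {k : V} (hk : k ∈ K) : Mp G U K k k := by
  refine ⟨h.sub hk, fun k' hk' => ⟨fun ha => ha.ne', fun hne => h.clique hk hk' hne.symm⟩⟩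

theorem two_nbrs [Finite V] (h : Big G U K) {x k1 k2 : V} (hx : x ∈ U) (hk1 : k1 ∈ K)
    (hk2 : k2 ∈ K) (hne : k1 ≠ k2) (h1 : G.Adj x k1) (h2 : G.Adj x k2) :
    ∃ k ∈ K, Mp G U K k x := by
  obtain ⟨k, hk, hxk⟩ := maxClique_nonadj h.sub h.clique h.max hx
  refine ⟨k, hk, hx, fun k' hk' => ⟨?_, ?_⟩⟩
  · rintro ha rfl
    exact hxk ha
  · intro hkk
    by_contra hc
    have ne1 : k1 ≠ k' := by rintro rfl; exact hc h1
    have ne2 : k1 ≠ k := by rintro rfl; exact hxk h1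
    have ne3 : k2 ≠ k' := by rintro rfl; exact hc h2
    have ne4 : k2 ≠ k := by rintro rfl; exact hxk h2
    exact h.hvn k1 k2 k' k x (h.clique hk1 hk2 hne) (h.clique hk1 hk' ne1)
      (h.clique hk1 hk ne2) (h.clique hk2 hk' ne3) (h.clique hk2 hk ne4)
      (h.clique hk' hk hkk) h1 h2 hc hxk

theorem rr_one [Finite V] (h : Big G U K) {x k1 k2 : V} (hx : Rr G U K x) (hk1 : k1 ∈ K)
    (hk2 : k2 ∈ K) (hne : k1 ≠ k2) (h1 : G.Adj x k1) : ¬ G.Adj x k2 := by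
  intro h2
  obtain ⟨k, hk, hm⟩ := h.two_nbrs hx.1 hk1 hk2 hne h1 h2
  exact hx.2 k hk hm

theorem mp_indep (h : Big G U K) {x y k : V} (hk : k ∈ K) (hx : Mp G U K k x)
    (hy : Mp G U K k y) : ¬ G.Adj x y := by
  classical
  intro hxy
  have hx' : ∀ z ∈ K.erase k, G.Adj x z := fun z hz =>
    (hx.2 z (Finset.mem_of_mem_erase hz)).2 (Finset.ne_of_mem_erase hz)
  have hy' : ∀ z ∈ K.erase k, G.Adj y z := fun z hz =>
    (hy.2 z (Finset.mem_of_mem_erase hz)).2 (Finset.ne_of_mem_erase hz)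
  have hyn : y ∉ K.erase k := fun hz => G.loopless.irrefl y (hy' y hz)
  have hxn : x ∉ insert y (K.erase k) := by
    rw [Finset.mem_insert, not_or]
    exact ⟨hxy.ne, fun hz => G.loopless.irrefl x (hx' x hz)⟩
  have h1 := h.max (insert x (insert y (K.erase k))) (by
    intro z hz
    simp only [Finset.mem_coe, Finset.mem_insert] at hz
    rcases hz with rfl | rfl | hz
    · exact hx.1
    · exact hy.1
    · exact h.sub (Finset.mem_of_mem_erase hz)) (by
    have h0 : G.IsClique (↑(K.erase k) : Set V) := fun a ha b hb hab =>
      h.clique (Finset.mem_of_mem_erase ha) (Finset.mem_of_mem_erase hb) hab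
    rw [Finset.coe_insert, Finset.coe_insert]
    refine (h0.insert (fun b hb _ => hy' b hb)).insert ?_
    intro b hb _
    rcases hb with rfl | hb
    · exact hxy
    · exact hx' b hb)
  rw [Finset.card_insert_of_notMem hxn, Finset.card_insert_of_notMem hyn,
    Finset.card_erase_of_mem hk] at h1
  have := h.four
  omega

theorem mp_adj (h : Big G U K) {x y k l : V} (hk : k ∈ K) (hl : l ∈ K) (hkl : k ≠ l)
    (hx : Mp G U K k x) (hy : Mp G U K l y) : G.Adj x y := by
  by_contra hxy
  obtain ⟨k3, hk3, n1, n2, _⟩ := h.pick k l l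
  obtain ⟨k4, hk4, n3, n4, n5⟩ := h.pick k l k3
  exact h.hvn k3 k4 x l y (h.clique hk3 hk4 n5.symm) ((hx.2 k3 hk3).2 n1).symm
    (h.clique hk3 hl n2) ((hx.2 k4 hk4).2 n3).symm (h.clique hk4 hl n4)
    ((hx.2 l hl).2 hkl.symm) ((hy.2 k3 hk3).2 n2) ((hy.2 k4 hk4).2 n4)
    (fun ha => hxy ha.symm) (fun ha => (hy.2 l hl).1 ha rfl)

theorem rr_K [Finite V] (h : Big G U K) {r m k j : V} (hr : Rr G U K r) (hj : j ∈ K)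
    (hm : Mp G U K k m) (hrm : G.Adj m r) (hjk : j ≠ k) : ¬ G.Adj r j := by
  intro hrj
  obtain ⟨k3, hk3, n1, n2, _⟩ := h.pick k j j
  obtain ⟨k4, hk4, n3, n4, n5⟩ := h.pick k j k3
  exact h.hvn m j k3 k4 r ((hm.2 j hj).2 hjk) ((hm.2 k3 hk3).2 n1) ((hm.2 k4 hk4).2 n3)
    (h.clique hj hk3 n2.symm) (h.clique hj hk4 n4.symm) (h.clique hk3 hk4 n5.symm)
    hrm.symm hrj (h.rr_one hr hj hk3 n2.symm hrj) (h.rr_one hr hj hk4 n4.symm hrj)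

theorem bb_uniq [Finite V] (h : Big G U K) {r m k l : V} (hr : Bb G U K k r) (hl : l ∈ K)
    (hkl : k ≠ l) (hm : Mp G U K l m) : ¬ G.Adj m r := by
  intro hmr
  obtain ⟨hk, hrr, x, hx, hxr⟩ := hr
  obtain ⟨k3, hk3, n1, n2, _⟩ := h.pick k l l
  obtain ⟨k4, hk4, n3, n4, n5⟩ := h.pick k l k3
  exact h.hvn x m k3 k4 r (h.mp_adj hk hl hkl hx hm) ((hx.2 k3 hk3).2 n1) ((hx.2 k4 hk4).2 n3)
    ((hm.2 k3 hk3).2 n2) ((hm.2 k4 hk4).2 n4) (h.clique hk3 hk4 n5.symm) hxr.symm hmr.symm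
    (h.rr_K hrr hk3 hx hxr n1) (h.rr_K hrr hk4 hx hxr n3)

theorem bb_eq [Finite V] (h : Big G U K) {r k l : V} (hr : Bb G U K k r)
    (hr' : Bb G U K l r) : k = l := by
  by_contra hkl
  obtain ⟨m, hm, hmr⟩ := hr'.2.2
  exact h.bb_uniq hr hr'.1 hkl hm hmr

theorem bbK [Finite V] (h : Big G U K) {r k l : V} (hr : Bb G U K k r) (hl : l ∈ K)
    (hkl : k ≠ l) : ¬ G.Adj l r := h.bb_uniq hr hl hkl (h.mp_self hl)

theorem aaK (h : Big G U K) {r l : V} (hr : Aa G U K r) (hl : l ∈ K) : ¬ G.Adj l r :=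
  hr.2 l hl l (h.mp_self hl)

theorem aa_or_bb {r : V} (hr : Rr G U K r) : Aa G U K r ∨ ∃ k, Bb G U K k r := by
  by_cases hb : ∃ k, Bb G U K k r
  · exact Or.inr hb
  · left
    refine ⟨hr, fun k hk m hm hmr => hb ⟨k, hk, hr, m, hm, hmr⟩⟩

theorem f1 [Finite V] (h : Big G U K) {i b d d' : V} (hb : Bb G U K i b) (hd : Aa G U K d)
    (hd' : Aa G U K d') (hdd : G.Adj d d') (hbd : G.Adj b d) : G.Adj b d' := by
  by_contra hc
  obtain ⟨hi, hr, m, hm, hmb⟩ := id hb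
  obtain ⟨j, hj, n1, _, _⟩ := h.pick i i i
  exact h.p5 j m b d d' ((hm.2 j hj).2 n1).symm hmb hbd hdd (h.bbK hb hj n1.symm)
    (h.aaK hd hj) (h.aaK hd' hj) (hd.2 i hi m hm) (hd'.2 i hi m hm) hc

theorem f2 [Finite V] (h : Big G U K) {i j b b' d : V} (hij : i ≠ j) (hb : Bb G U K i b)
    (hb' : Bb G U K j b') (hd : Aa G U K d) (hbb : ¬ G.Adj b b') : ¬ G.Adj b d := by
  intro hbd
  obtain ⟨hi, _, m, hm, hmb⟩ := id hb
  obtain ⟨hj, _, m', hm', hmb'⟩ := id hb'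
  obtain ⟨k, hk, n1, n2, _⟩ := h.pick i j j
  by_cases hdb : G.Adj d b'
  · exact h.p5 k m b d b' ((hm.2 k hk).2 n1).symm hmb hbd hdb (h.bbK hb hk n1.symm)
      (h.aaK hd hk) (h.bbK hb' hk n2.symm) (hd.2 i hi m hm) (h.bb_uniq hb' hi hij.symm hm) hbb
  · exact h.p5 d b m m' b' hbd.symm hmb.symm (h.mp_adj hi hj hij hm hm') hmb'
      (fun ha => hd.2 i hi m hm ha.symm) (fun ha => hd.2 j hj m' hm' ha.symm) hdb
      (fun ha => h.bb_uniq hb hj hij hm' ha.symm) hbb (h.bb_uniq hb' hi hij.symm hm)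

theorem f3 [Finite V] (h : Big G U K) {i j b b' d : V} (hij : i ≠ j) (hb : Bb G U K i b)
    (hb' : Bb G U K j b') (hd : Aa G U K d) (hbb : G.Adj b b') (hdb : G.Adj d b) :
    G.Adj d b' := by
  by_contra hc
  obtain ⟨hj, _, m', hm', hmb'⟩ := id hb'
  obtain ⟨k, hk, n1, n2, _⟩ := h.pick i j j
  exact h.p5 d b b' m' k hdb hbb hmb'.symm ((hm'.2 k hk).2 n2) hc
    (fun ha => hd.2 j hj m' hm' ha.symm) (fun ha => h.aaK hd hk ha.symm)
    (fun ha => h.bb_uniq hb hj hij hm' ha.symm) (fun ha => h.bbK hb hk n1.symm ha.symm)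
    (fun ha => h.bbK hb' hk n2.symm ha.symm)

theorem f4 [Finite V] (h : Big G U K) {i j b b1 b' : V} (hij : i ≠ j) (hb : Bb G U K i b)
    (hb1 : Bb G U K i b1) (hb' : Bb G U K j b') (hbb : G.Adj b b1) (hab : G.Adj b' b) :
    G.Adj b' b1 := by
  by_contra hc
  obtain ⟨hj, _, m', hm', hmb'⟩ := id hb'
  obtain ⟨k, hk, n1, n2, _⟩ := h.pick i j j
  exact h.p5 b1 b b' m' k hbb.symm hab.symm hmb'.symm ((hm'.2 k hk).2 n2)
    (fun ha => hc ha.symm) (fun ha => h.bb_uniq hb1 hj hij hm' ha.symm)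
    (fun ha => h.bbK hb1 hk n1.symm ha.symm) (fun ha => h.bb_uniq hb hj hij hm' ha.symm)
    (fun ha => h.bbK hb hk n1.symm ha.symm) (fun ha => h.bbK hb' hk n2.symm ha.symm)

theorem f5 [Finite V] (h : Big G U K) {i j b b1 b' m : V} (hij : i ≠ j) (hb : Bb G U K i b)
    (hb1 : Bb G U K i b1) (hb' : Bb G U K j b') (hbb : G.Adj b b1) (hm : Mp G U K i m)
    (hmb : G.Adj m b) (hmb1 : ¬ G.Adj m b1) : G.Adj b' b := by
  by_contra hc
  have hi := hb.1
  obtain ⟨hj, _, m', hm', hmb'⟩ := id hb'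
  obtain ⟨k, hk, n1, n2, _⟩ := h.pick i j j
  by_cases h1 : G.Adj b1 b'
  · exact h.p5 k m b b1 b' ((hm.2 k hk).2 n1).symm hmb hbb h1 (h.bbK hb hk n1.symm)
      (h.bbK hb1 hk n1.symm) (h.bbK hb' hk n2.symm) hmb1 (h.bb_uniq hb' hi hij.symm hm)
      (fun ha => hc ha.symm)
  · exact h.p5 b1 b m m' b' hbb.symm hmb.symm (h.mp_adj hi hj hij hm hm') hmb'
      (fun ha => hmb1 ha.symm) (fun ha => h.bb_uniq hb1 hj hij hm' ha.symm) h1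
      (fun ha => h.bb_uniq hb hj hij hm' ha.symm) (fun ha => hc ha.symm)
      (h.bb_uniq hb' hi hij.symm hm)

theorem f6 [Finite V] (h : Big G U K) {i j l x y z : V} (hij : i ≠ j) (hil : i ≠ l)
    (hx : Bb G U K i x) (hy : Bb G U K j y) (hz : Bb G U K l z) (hxy : G.Adj x y)
    (hyz : G.Adj y z) : G.Adj x z := by
  by_contra hc
  obtain ⟨hi, _, m, hm, hmb⟩ := id hx
  obtain ⟨k, hk, n1, n2, n3⟩ := h.pick i j l
  exact h.p5 k m x y z ((hm.2 k hk).2 n1).symm hmb hxy hyz (h.bbK hx hk n1.symm)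
    (h.bbK hy hk n2.symm) (h.bbK hz hk n3.symm) (h.bb_uniq hy hi hij.symm hm)
    (h.bb_uniq hz hi hil.symm hm) hc

theorem f7 [Finite V] (h : Big G U K) {i j l x y z : V} (hij : i ≠ j) (hil : i ≠ l)
    (hjl : j ≠ l) (hx : Bb G U K i x) (hy : Bb G U K j y) (hz : Bb G U K l z)
    (hxz : G.Adj x z) : G.Adj y x ∨ G.Adj y z := by
  by_contra hc
  push Not at hc
  obtain ⟨hi, _, m, hm, hmb⟩ := id hx
  obtain ⟨hj, _, m', hm', hmb'⟩ := id hy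
  exact h.p5 y m' m x z hmb'.symm (h.mp_adj hi hj hij hm hm').symm hmb hxz
    (fun ha => h.bb_uniq hy hi hij.symm hm ha.symm) hc.1 hc.2 (h.bb_uniq hx hj hij hm')
    (h.bb_uniq hz hj hjl.symm hm') (h.bb_uniq hz hi hil.symm hm)

/-- Combine a colouring of the rest with a colouring of the parts. -/
theorem combine (h : Big G U K) {N : ℕ} (c fR : V → ℕ)
    (hc : ∀ k ∈ K, ∀ l ∈ K, c k = c l → k = l) (hcN : ∀ k ∈ K, c k < N)
    (hf : PropOn G {x | Rr G U K x} fR) (hfN : ∀ x, Rr G U K x → fR x < N)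
    (hfc : ∀ k x, Bb G U K k x → fR x ≠ c k) :
    ∃ f : V → ℕ, PropOn G U f ∧ ∀ x ∈ U, f x < N := by
  classical
  have hex : ∀ x, ∃ k, (∃ k ∈ K, Mp G U K k x) → k ∈ K ∧ Mp G U K k x := by
    intro x
    by_cases hx : ∃ k ∈ K, Mp G U K k x
    · obtain ⟨k, hk⟩ := hx
      exact ⟨k, fun _ => hk⟩
    · exact ⟨x, fun h => absurd h hx⟩
  choose p hp using hex
  have hR : ∀ x ∈ U, (¬ ∃ k ∈ K, Mp G U K k x) → Rr G U K x := by
    intro x hx hn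
    exact ⟨hx, fun k hk hm => hn ⟨k, hk, hm⟩⟩
  refine ⟨fun x => if ∃ k ∈ K, Mp G U K k x then c (p x) else fR x, ?_, ?_⟩
  · intro x hx y hy hxy
    by_cases h1 : ∃ k ∈ K, Mp G U K k x
    · by_cases h2 : ∃ k ∈ K, Mp G U K k y
      · simp only [if_pos h1, if_pos h2]
        intro he
        have h3 := hc _ (hp x h1).1 _ (hp y h2).1 he
        have h4 := (hp y h2).2
        rw [← h3] at h4
        exact h.mp_indep (hp x h1).1 (hp x h1).2 h4 hxy
      · simp only [if_pos h1, if_neg h2]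
        exact (hfc (p x) y ⟨(hp x h1).1, hR y hy h2, x, (hp x h1).2, hxy⟩).symm
    · by_cases h2 : ∃ k ∈ K, Mp G U K k y
      · simp only [if_neg h1, if_pos h2]
        exact hfc (p y) x ⟨(hp y h2).1, hR x hx h1, y, (hp y h2).2, hxy.symm⟩
      · simp only [if_neg h1, if_neg h2]
        exact hf x (hR x hx h1) y (hR y hy h2) hxy
  · intro x hx
    by_cases h1 : ∃ k ∈ K, Mp G U K k x
    · simp only [if_pos h1]
      exact hcN _ (hp x h1).1
    · simp only [if_neg h1]
      exact hfN x (hR x hx h1)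

/-- Case I: only one class of attachments. -/
theorem case1 [Finite V] (h : Big G U K) {k1 : V} (hk1 : k1 ∈ K)
    (honly : ∀ k x, Bb G U K k x → k = k1) :
    ∃ f : V → ℕ, PropOn G U f ∧ ∀ x ∈ U, f x < K.card + 3 := by
  classical
  obtain ⟨k2, hk2, hk12, _⟩ := h.pick k1 k1 k1
  obtain ⟨fR, h1, h2⟩ := comp_color (G := G) {x | Rr G U K x} (fun _ c => c < K.card + 2) (by
    intro x hx
    have hsub := cmpt_sub (G := G) hx
    obtain ⟨d, hd, u, huU, huR, hud⟩ := exit_comp (h.conn x hx.1 k1 (h.sub hk1)) hx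
      (fun hk => hk.2 k1 hk1 (h.mp_self hk1))
    have hu : ∃ k ∈ K, Mp G U K k u := by
      by_contra hn
      push Not at hn
      exact huR ⟨huU, hn⟩
    obtain ⟨k, hk, hmu⟩ := hu
    have hkk := honly k d ⟨hk, hsub hd, u, hmu, hud⟩
    subst hkk
    exact caseI_comp h.p5 h.hvn h.four h.max (fun y hy => (hsub hy).1) (conn_cmpt hx) huU
      (((hmu.2 k2 hk2).2 hk12).symm) (fun y hy hadj =>
        hk12 (honly k2 y ⟨hk2, hsub hy, k2, h.mp_self hk2, hadj⟩)) hd hud)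
  obtain ⟨e, he, he'⟩ := finset_index K
  refine h.combine (fun k => if k = k1 then K.card + 2 else e k) fR ?_ ?_ h1
    (fun x hx => by have := h2 x hx; omega) ?_
  · intro k hk l hl heq
    have e1 := he' k hk
    have e2 := he' l hl
    by_cases c1 : k = k1 <;> by_cases c2 : l = k1 <;> simp only [c1, c2, if_true, if_false] at heq
    · rw [c1, c2]
    · omega
    · omega
    · exact he k hk l hl heq
  · intro k hk
    have e1 := he' k hk
    show (if k = k1 then K.card + 2 else e k) < K.card + 3
    split_ifs <;> omega
  · intro k x hb
    have := honly k x hb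
    subst this
    simp only [if_true]
    have := h2 x hb.2.1
    omega

end Big

namespace Big
variable {V : Type*} {G : SimpleGraph V} {U : Set V} {K : Finset V}

theorem exists_shift (R : Set V) (f g : V → ℕ) (n N : ℕ) (hN : n < N) (hf : ∀ r ∈ R, f r < n)
    (hg : ∀ r ∈ R, ∀ r' ∈ R, f r = f r' → g r = g r') :
    ∃ s < N, ∀ r ∈ R, (f r + s) % N ≠ g r := by
  classical
  let F : ℕ → ℕ := fun t => if h : ∃ r, r ∈ R ∧ f r = t then (g h.choose + (N - t)) % N else 0
  have hcard : ((Finset.range n).image F).card < (Finset.range N).card := by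
    refine lt_of_le_of_lt Finset.card_image_le ?_
    simpa using hN
  obtain ⟨s, hs, hs'⟩ := Finset.exists_mem_notMem_of_card_lt_card hcard
  rw [Finset.mem_range] at hs
  refine ⟨s, hs, ?_⟩
  intro r hr he
  apply hs'
  rw [Finset.mem_image]
  refine ⟨f r, Finset.mem_range.2 (hf r hr), ?_⟩
  have hex : ∃ r', r' ∈ R ∧ f r' = f r := ⟨r, hr, rfl⟩
  have h1 : g hex.choose = g r := hg _ hex.choose_spec.1 r hr hex.choose_spec.2
  have h2 : F (f r) = (g hex.choose + (N - f r)) % N := dif_pos hex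
  rw [h2, h1, ← he]
  have h3 := hf r hr
  have h4 : (f r + s) % N + (N - f r) ≡ f r + s + (N - f r) [MOD N] :=
    Nat.ModEq.add_right _ (Nat.mod_modEq _ _)
  have h5 : f r + s + (N - f r) = s + N := by omega
  rw [h5] at h4
  have h6 : ((f r + s) % N + (N - f r)) % N = (s + N) % N := h4
  rw [h6, Nat.add_mod_right, Nat.mod_eq_of_lt hs]

theorem exists_lab [Finite V] (h : Big G U K) : ∃ lab : V → Option V,
    (∀ k r, Bb G U K k r ↔ Rr G U K r ∧ lab r = some k) ∧
    (∀ r, Rr G U K r → (lab r = none ↔ Aa G U K r)) := by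
  classical
  refine ⟨fun r => if h : ∃ k, Bb G U K k r then some h.choose else none, ?_, ?_⟩
  · intro k r
    constructor
    · intro hb
      have hex : ∃ k, Bb G U K k r := ⟨k, hb⟩
      refine ⟨hb.2.1, ?_⟩
      simp only [dif_pos hex]
      rw [h.bb_eq hb hex.choose_spec]
    · rintro ⟨h1, h2⟩
      by_cases hex : ∃ k, Bb G U K k r
      · simp only [dif_pos hex] at h2
        have := hex.choose_spec
        rw [Option.some.inj h2] at this
        exact this
      · simp only [dif_neg hex] at h2
        exact absurd h2 (by simp)
  · intro r hr
    constructor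
    · intro h2
      by_cases hex : ∃ k, Bb G U K k r
      · simp only [dif_pos hex] at h2
        exact absurd h2 (by simp)
      · exact (aa_or_bb hr).resolve_right hex
    · intro ha
      refine dif_neg ?_
      rintro ⟨k, hk, _, m, hm, hmr⟩
      exact ha.2 k hk m hm hmr

theorem multi [Finite V] (h : Big G U K) (lab : V → Option V)
    (hl : ∀ k r, Bb G U K k r ↔ Rr G U K r ∧ lab r = some k)
    (hadj : ∀ r r', Rr G U K r → Rr G U K r' → lab r ≠ lab r' → G.Adj r r')
    {r1 r2 r3 : V} (h1 : Rr G U K r1) (h2 : Rr G U K r2) (h3 : Rr G U K r3)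
    (h12 : lab r1 ≠ lab r2) (h13 : lab r1 ≠ lab r3) (h23 : lab r2 ≠ lab r3) :
    ∃ f : V → ℕ, PropOn G U f ∧ ∀ x ∈ U, f x < K.card + 3 := by
  classical
  have hpq : ∀ x, Rr G U K x → ∃ p q, Rr G U K p ∧ Rr G U K q ∧ lab p ≠ lab x ∧ lab q ≠ lab x ∧
      lab p ≠ lab q := by
    intro x hx
    by_cases c1 : lab r1 = lab x
    · exact ⟨r2, r3, h2, h3, by rw [← c1]; exact h12.symm, by rw [← c1]; exact h13.symm, h23⟩
    · by_cases c2 : lab r2 = lab x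
      · exact ⟨r1, r3, h1, h3, c1, by rw [← c2]; exact h23.symm, h13⟩
      · exact ⟨r1, r2, h1, h2, c1, c2, h12⟩
  have hNT : NonTrans G {x | Rr G U K x} := by
    intro x hx y hy z hz hxy hyz hxz
    have e1 : lab x = lab y := by
      by_contra hc
      exact hxy (hadj x y hx hy hc)
    have e2 : lab y = lab z := by
      by_contra hc
      exact hyz (hadj y z hy hz hc)
    obtain ⟨p, q, hp, hq, n1, n2, n3⟩ := hpq y hy
    exact h.hvn p q x z y (hadj _ _ hp hq n3) (hadj _ _ hp hx (by rw [e1]; exact n1))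
      (hadj _ _ hp hz (by rw [← e2]; exact n1)) (hadj _ _ hq hx (by rw [e1]; exact n2))
      (hadj _ _ hq hz (by rw [← e2]; exact n2)) hxz (hadj _ _ hy hp n1.symm)
      (hadj _ _ hy hq n2.symm) (fun ha => hxy ha.symm) hyz
  obtain ⟨f, q, p1, p2, p3, p4, p5⟩ := cm_color hNT
  have hqn : q.card ≤ K.card := h.max q (fun x hx => (p2 hx).1) p3
  obtain ⟨e, he, he'⟩ := finset_index K
  obtain ⟨s, hs, hs'⟩ := exists_shift {x | Rr G U K x} f (fun r => (lab r).elim 0 e) K.card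
    (K.card + 3) (by omega) (fun r hr => lt_of_lt_of_le (p4 r hr) hqn) (by
      intro r hr r' hr' heq
      have : lab r = lab r' := by
        by_contra hc
        exact p1 r hr r' hr' (hadj r r' hr hr' hc) heq
      simp only [this])
  refine h.combine e (fun r => (f r + s) % (K.card + 3)) he
    (fun k hk => by have := he' k hk; omega) ?_ (fun x _ => Nat.mod_lt _ (by omega)) ?_
  · intro x hx y hy hxy heq
    have heq : f x + s ≡ f y + s [MOD (K.card + 3)] := heq
    have h4 := Nat.ModEq.add_right_cancel' s heq
    have a1 := p4 x hx
    have a2 := p4 y hy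
    exact p1 x hx y hy hxy (Nat.ModEq.eq_of_lt_of_lt h4 (by omega) (by omega))
  · intro k x hb
    have h4 := hs' x hb.2.1
    simp only [((hl k x).1 hb).2, Option.elim_some] at h4
    exact h4

/-- Colouring one class of attachments. -/
theorem class_color [Finite V] (h : Big G U K) (hA : ∀ x, ¬ Aa G U K x) {i j b0 : V}
    (hij : i ≠ j) (hb0 : Bb G U K j b0) :
    ∃ f : V → ℕ, PropOn G {x | Bb G U K i x} f ∧ ∀ y ∈ {x | Bb G U K i x}, ∃ q : Finset V,
      (↑q : Set V) ⊆ cmpt G {x | Bb G U K i x} y ∧ G.IsClique (↑q : Set V) ∧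
      f y ≤ q.card ∧ q.card + 1 ≤ K.card := by
  refine comp_color (G := G) {x | Bb G U K i x} (fun y c => ∃ q : Finset V,
      (↑q : Set V) ⊆ cmpt G {x | Bb G U K i x} y ∧ G.IsClique (↑q : Set V) ∧
      c ≤ q.card ∧ q.card + 1 ≤ K.card) ?_
  intro x hx
  have hsub := cmpt_sub (G := G) hx
  have hp : ∃ p ∈ U, ∀ y ∈ cmpt G {x | Bb G U K i x} x, G.Adj p y := by
    by_cases hc : ∃ l b', l ≠ i ∧ Bb G U K l b' ∧ ∃ y ∈ cmpt G {x | Bb G U K i x} x, G.Adj b' y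
    · obtain ⟨l, b', hli, hb', y, hy, hby⟩ := hc
      refine ⟨b', hb'.2.1.1, fun z hz => ?_⟩
      refine Rch.inv (Rch.trans (Rch.symm hy) hz) (fun z => G.Adj b' z) ?_ hby
      intro u hu v hv huv hbu
      exact h.f4 hli.symm hu hv hb' huv hbu
    · obtain ⟨hi, hr, m, hm, hmx⟩ := id hx
      refine ⟨m, hm.1, fun z hz => ?_⟩
      refine (Rch.inv hz (fun z => z ∈ cmpt G {x | Bb G U K i x} x ∧ G.Adj m z) ?_
        ⟨mem_cmpt_self x, hmx⟩).2
      rintro u hu v hv huv ⟨huc, hmu⟩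
      refine ⟨cmpt_closed huc hu hv huv, ?_⟩
      by_contra hmv
      exact hc ⟨j, b0, hij.symm, hb0, u, huc, h.f5 hij hu hv hb0 huv hm hmu hmv⟩
  obtain ⟨p, hpU, hp⟩ := hp
  obtain ⟨f, q, h1, h2, h3, h4⟩ := paw_color' h.p5 h.hvn (conn_cmpt hx) hp
  have h5 := cliqueLe_nbr h.max (fun y hy => (hsub hy).2.1.1) hpU hp q h2 h3
  have := h.four
  refine ⟨f, h1, fun y hy => ⟨q, ?_, h3, h4 y hy, by omega⟩⟩
  rw [← cmpt_eq hy]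
  exact h2

theorem case2c1 [Finite V] (h : Big G U K) (hA : ∀ x, ¬ Aa G U K x) {i j b b' : V}
    (hij : i ≠ j) (hb : Bb G U K i b) (hb' : Bb G U K j b')
    (hno : ∀ k l x y, Bb G U K k x → Bb G U K l y → k ≠ l → ¬ G.Adj x y) :
    ∃ f : V → ℕ, PropOn G U f ∧ ∀ x ∈ U, f x < K.card + 3 := by
  classical
  have hF : ∀ k, ∃ f : V → ℕ, PropOn G {x | Bb G U K k x} f ∧
      ∀ y, Bb G U K k y → f y < K.card := by
    intro k
    have hj : ∃ j b0, k ≠ j ∧ Bb G U K j b0 := by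
      by_cases hk : k = i
      · exact ⟨j, b', by rw [hk]; exact hij, hb'⟩
      · exact ⟨i, b, hk, hb⟩
    obtain ⟨j, b0, hkj, hb0⟩ := hj
    obtain ⟨f, h1, h2⟩ := h.class_color hA hkj hb0
    refine ⟨f, h1, fun y hy => ?_⟩
    obtain ⟨q, _, _, h3, h4⟩ := h2 y hy
    omega
  choose F hF1 hF2 using hF
  have hcl : ∀ r, ∃ k, Rr G U K r → Bb G U K k r := by
    intro r
    by_cases hr : Rr G U K r
    · obtain ⟨k, hk⟩ := (aa_or_bb hr).resolve_left (hA r)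
      exact ⟨k, fun _ => hk⟩
    · exact ⟨r, fun h => absurd h hr⟩
  choose cl hcl using hcl
  obtain ⟨e, he, he'⟩ := finset_index K
  refine h.combine e (fun r => if F (cl r) r < e (cl r) then F (cl r) r else F (cl r) r + 1) he
    (fun k hk => by have := he' k hk; omega) ?_ ?_ ?_
  · intro x hx y hy hxy heq
    have hc : cl x = cl y := by
      by_contra hc
      exact hno _ _ x y (hcl x hx) (hcl y hy) hc hxy
    have hy' := hcl y hy
    rw [← hc] at hy'
    have h1 := hF1 (cl x) x (hcl x hx) y hy' hxy
    simp only [← hc] at heq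
    split_ifs at heq <;> omega
  · intro x hx
    have := hF2 _ x (hcl x hx)
    show (if F (cl x) x < e (cl x) then F (cl x) x else F (cl x) x + 1) < K.card + 3
    split_ifs <;> omega
  · intro k x hbk
    have := h.bb_eq hbk (hcl x hbk.2.1)
    subst this
    show (if F (cl x) x < e (cl x) then F (cl x) x else F (cl x) x + 1) ≠ e (cl x)
    split_ifs <;> omega

theorem case2c2 [Finite V] (h : Big G U K) (hA : ∀ x, ¬ Aa G U K x) {i j b b' : V}
    (hij : i ≠ j) (hb : Bb G U K i b) (hb' : Bb G U K j b')
    (honly : ∀ k x, Bb G U K k x → k = i ∨ k = j) :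
    ∃ f : V → ℕ, PropOn G U f ∧ ∀ x ∈ U, f x < K.card + 3 := by
  classical
  obtain ⟨f1, a1, a2⟩ := h.class_color hA hij hb'
  obtain ⟨f2, c1, c2⟩ := h.class_color hA hij.symm hb
  have hor : ∀ r, Rr G U K r → ¬ Bb G U K i r → Bb G U K j r := by
    intro r hr hn
    obtain ⟨k, hk⟩ := (aa_or_bb hr).resolve_left (hA r)
    rcases honly k r hk with rfl | rfl
    · exact absurd hk hn
    · exact hk
  have hcross : ∀ x y, Bb G U K i x → Bb G U K j y → G.Adj x y → f1 x + f2 y ≤ K.card := by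
    intro x y hx hy hxy
    obtain ⟨q1, s1, s2, s3, s4⟩ := a2 x hx
    obtain ⟨q2, t1, t2, t3, t4⟩ := c2 y hy
    have hx' := cmpt_sub (G := G) (T := {x | Bb G U K i x}) hx
    have hy' := cmpt_sub (G := G) (T := {x | Bb G U K j x}) hy
    have j1 : ∀ u ∈ cmpt G {x | Bb G U K i x} x, G.Adj y u := by
      intro u hu
      refine Rch.inv hu (fun z => G.Adj y z) ?_ hxy.symm
      intro p hp q hq hpq hyp
      exact h.f4 hij hp hq hy hpq hyp
    have j2 : ∀ u ∈ cmpt G {x | Bb G U K i x} x, ∀ v ∈ cmpt G {x | Bb G U K j x} y,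
        G.Adj u v := by
      intro u hu v hv
      refine Rch.inv hv (fun z => G.Adj u z) ?_ (j1 u hu).symm
      intro p hp q hq hpq hup
      exact h.f4 hij.symm hp hq (hx' hu) hpq hup
    have hdis : Disjoint q1 q2 := by
      rw [Finset.disjoint_left]
      intro z hz1 hz2
      exact G.loopless.irrefl z (j2 z (s1 hz1) z (t1 hz2))
    have h1 := h.max (q1 ∪ q2) (by
      intro z hz
      rw [Finset.mem_coe, Finset.mem_union] at hz
      rcases hz with hz | hz
      · exact (hx' (s1 hz)).2.1.1
      · exact (hy' (t1 hz)).2.1.1) (by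
      intro u hu v hv huv
      rw [Finset.mem_coe, Finset.mem_union] at hu hv
      rcases hu with hu | hu <;> rcases hv with hv | hv
      · exact s2 hu hv huv
      · exact j2 u (s1 hu) v (t1 hv)
      · exact (j2 v (s1 hv) u (t1 hu)).symm
      · exact t2 hu hv huv)
    rw [Finset.card_union_of_disjoint hdis] at h1
    omega
  have b1 : ∀ x, Bb G U K i x → f1 x + 1 ≤ K.card := fun x hx => by
    obtain ⟨q, _, _, h3, h4⟩ := a2 x hx
    omega
  have b2 : ∀ x, Bb G U K j x → f2 x + 1 ≤ K.card := fun x hx => by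
    obtain ⟨q, _, _, h3, h4⟩ := c2 x hx
    omega
  obtain ⟨e, he, he'⟩ := finset_index K
  refine h.combine (fun k => if k = i then K.card + 2 else if k = j then 0 else e k + 1)
    (fun r => if Bb G U K i r then f1 r else K.card + 2 - f2 r) ?_ ?_ ?_ ?_ ?_
  · intro k hk l hl heq
    have e1 := he' k hk
    have e2 := he' l hl
    have e3 := he k hk l hl
    by_cases d1 : k = i
    · by_cases d2 : l = i
      · rw [d1, d2]
      · rw [if_pos d1, if_neg d2] at heq
        split_ifs at heq
        omega
    · by_cases d2 : l = i
      · rw [if_neg d1, if_pos d2] at heq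
        split_ifs at heq
        omega
      · rw [if_neg d1, if_neg d2] at heq
        by_cases d3 : k = j <;> by_cases d4 : l = j
        · rw [d3, d4]
        · rw [if_pos d3, if_neg d4] at heq
          omega
        · rw [if_neg d3, if_pos d4] at heq
          omega
        · rw [if_neg d3, if_neg d4] at heq
          exact e3 (by omega)
  · intro k hk
    have e1 := he' k hk
    show (if k = i then K.card + 2 else if k = j then 0 else e k + 1) < K.card + 3
    split_ifs <;> omega
  · intro x hx y hy hxy
    by_cases d1 : Bb G U K i x <;> by_cases d2 : Bb G U K i y <;>
      simp only [d1, d2, if_true, if_false]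
    · exact a1 x d1 y d2 hxy
    · have := hcross x y d1 (hor y hy d2) hxy
      omega
    · have := hcross y x d2 (hor x hx d1) hxy.symm
      omega
    · have e1 := c1 x (hor x hx d1) y (hor y hy d2) hxy
      have e2 := b2 x (hor x hx d1)
      have e3 := b2 y (hor y hy d2)
      omega
  · intro x hx
    by_cases d1 : Bb G U K i x <;> simp only [d1, if_true, if_false]
    · have := b1 x d1
      omega
    · omega
  · intro k x hk
    rcases honly k x hk with rfl | rfl
    · simp only [hk, if_true]
      have := b1 x hk
      omega
    · have d1 : ¬ Bb G U K i x := fun hh => hij (h.bb_eq hh hk)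
      simp only [d1, if_false, hij.symm, if_true]
      have := b2 x hk
      omega

theorem color [Finite V] (h : Big G U K) :
    ∃ f : V → ℕ, PropOn G U f ∧ ∀ x ∈ U, f x < K.card + 3 := by
  classical
  by_cases hI : ∀ k l x y, Bb G U K k x → Bb G U K l y → k = l
  · by_cases hex : ∃ k x, Bb G U K k x
    · obtain ⟨k, x, hk⟩ := hex
      exact h.case1 hk.1 (fun l y hl => hI l k y x hl hk)
    · obtain ⟨k, hk⟩ := Finset.card_pos.1 (by have := h.four; omega : 0 < K.card)
      exact h.case1 hk (fun l y hl => absurd ⟨l, y, hl⟩ hex)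
  push Not at hI
  obtain ⟨i, j, b, b', hb, hb', hij⟩ := hI
  obtain ⟨lab, hl, hl'⟩ := h.exists_lab
  have hlB : ∀ {k x}, Bb G U K k x → lab x = some k := fun hx => ((hl _ _).1 hx).2
  by_cases hA : ∃ d, Aa G U K d
  · have hother : ∀ k, ∃ l c, k ≠ l ∧ Bb G U K l c := by
      intro k
      by_cases hk : k = i
      · exact ⟨j, b', by rw [hk]; exact hij, hb'⟩
      · exact ⟨i, b, hk, hb⟩
    have hfull : ∀ d, Aa G U K d → ∀ k x, Bb G U K k x → G.Adj d x := by
      intro d hd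
      obtain ⟨d1, hd1, u, huU, huA, hud⟩ := exit_comp (R := {x | Aa G U K x})
        (h.conn d hd.1.1 b hb.2.1.1) hd (fun ha => by
          obtain ⟨hi, _, m, hm, hmb⟩ := hb
          exact ha.2 i hi m hm hmb)
      have hd1A : Aa G U K d1 := cmpt_sub (G := G) (T := {x | Aa G U K x}) hd hd1
      have huR : Rr G U K u := by
        refine ⟨huU, fun k hk hm => ?_⟩
        exact hd1A.2 k hk u hm hud
      obtain ⟨k, hku⟩ := (aa_or_bb huR).resolve_left huA
      have hud' : G.Adj u d := by
        refine Rch.inv (Rch.symm hd1) (fun z => G.Adj u z) ?_ hud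
        intro p hp q hq hpq hup
        exact h.f1 hku hp hq hpq hup
      have step : ∀ k l x y, Bb G U K k x → Bb G U K l y → k ≠ l → G.Adj x d → G.Adj y d := by
        intro k l x y hx hy hkl hxd
        have hxy : G.Adj x y := by
          by_contra hn
          exact h.f2 hkl hx hy hd hn hxd
        exact (h.f3 hkl hx hy hd hxy hxd.symm).symm
      obtain ⟨l, c, hkl, hc⟩ := hother k
      have hcd := step k l u c hku hc hkl hud'
      intro k' x hx
      by_cases hk' : k' = k
      · subst hk'
        exact (step l k' c x hc hx hkl.symm hcd).symm
      · exact (step k k' u x hku hx (Ne.symm hk') hud').symm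
    obtain ⟨d, hd⟩ := hA
    have hlA : ∀ {x}, Aa G U K x → lab x = none := fun hx => (hl' _ hx.1).2 hx
    refine h.multi lab hl ?_ hd.1 hb.2.1 hb'.2.1 ?_ ?_ ?_
    · intro r r' hr hr' hne
      rcases aa_or_bb hr with ha | ⟨k, hk⟩ <;> rcases aa_or_bb hr' with ha' | ⟨k', hk'⟩
      · exact absurd ((hlA ha).trans (hlA ha').symm) hne
      · exact hfull r ha k' r' hk'
      · exact (hfull r' ha' k r hk).symm
      · by_contra hn
        have hkk : k ≠ k' := by
          rintro rfl
          exact hne ((hlB hk).trans (hlB hk').symm)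
        exact h.f2 hkk hk hk' hd hn (hfull d hd k r hk).symm
    · rw [hlA hd, hlB hb]; simp
    · rw [hlA hd, hlB hb']; simp
    · rw [hlB hb, hlB hb']
      simpa using hij
  · push Not at hA
    by_cases hno : ∀ k l x y, Bb G U K k x → Bb G U K l y → k ≠ l → ¬ G.Adj x y
    · exact h.case2c1 hA hij hb hb' hno
    push Not at hno
    obtain ⟨k, l, x, y, hx, hy, hkl, hxy⟩ := hno
    by_cases honly : ∀ k' z, Bb G U K k' z → k' = k ∨ k' = l
    · exact h.case2c2 hA hkl hx hy honly
    push Not at honly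
    obtain ⟨p, z, hz, hpk, hpl⟩ := honly
    -- every edge dominates
    have third : ∀ k l x y p z, Bb G U K k x → Bb G U K l y → Bb G U K p z → k ≠ l → p ≠ k →
        p ≠ l → G.Adj x y → G.Adj z x ∧ G.Adj z y := by
      intro k l x y p z hx hy hz hkl hpk hpl hxy
      rcases h.f7 hpk.symm hkl hpl hx hz hy hxy with hh | hh
      · exact ⟨hh, h.f6 hpk hpl hz hx hy hh hxy⟩
      · exact ⟨h.f6 hpl hpk hz hy hx hh hxy.symm, hh⟩
    obtain ⟨hzx, hzy⟩ := third k l x y p z hx hy hz hkl hpk hpl hxy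
    have nb : ∀ q w, Bb G U K q w → (q ≠ k → G.Adj w x) ∧ (q ≠ l → G.Adj w y) := by
      intro q w hw
      constructor
      · intro hqk
        by_cases hql : q = l
        · subst hql
          exact (third p k z x q w hz hx hw hpk hpl.symm hqk hzx).2
        · exact (third k l x y q w hx hy hw hkl hqk hql hxy).1
      · intro hql
        by_cases hqk : q = k
        · subst hqk
          exact (third p l z y q w hz hy hw hpl hpk.symm hql hzy).2
        · exact (third k l x y q w hx hy hw hkl hqk hql hxy).2
    have full : ∀ q w q' w', Bb G U K q w → Bb G U K q' w' → q ≠ q' → G.Adj w w' := by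
      intro q w q' w' hw hw' hqq
      by_cases c1 : q = k
      · subst c1
        have h1 := (nb q w hw).2 hkl
        by_cases c2 : q' = l
        · subst c2
          -- use z
          have e1 : G.Adj w z := (third q q' w y p z hw hy hz hkl hpk hpl h1).1.symm
          exact (third p q z w q' w' hz hw hw' hpk hpl.symm hkl.symm e1.symm).2.symm
        · exact (third q l w y q' w' hw hy hw' hkl hqq.symm c2 h1).1.symm
      · have h1 := (nb q w hw).1 c1
        by_cases c2 : q' = k
        · subst c2
          have h2 := (nb q' w' hw').2 hkl
          by_cases c3 : q = l
          · subst c3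
            have e1 : G.Adj w' z := (third q' q w' y p z hw' hy hz hkl hpk hpl h2).1.symm
            exact (third p q' z w' q w hz hw' hw hpk hpl.symm hkl.symm e1.symm).2
          · exact (third q' l w' y q w hw' hy hw hkl c1 c3 h2).1
        · exact (third q k w x q' w' hw hx hw' c1 hqq.symm c2 h1).1.symm
    refine h.multi lab hl ?_ hx.2.1 hy.2.1 hz.2.1 ?_ ?_ ?_
    · intro r r' hr hr' hne
      obtain ⟨q, hq⟩ := (aa_or_bb hr).resolve_left (hA r)
      obtain ⟨q', hq'⟩ := (aa_or_bb hr').resolve_left (hA r')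
      refine full q r q' r' hq hq' ?_
      rintro rfl
      exact hne ((hlB hq).trans (hlB hq').symm)
    · rw [hlB hx, hlB hy]; simpa using hkl
    · rw [hlB hx, hlB hz]; simpa using hpk.symm
    · rw [hlB hy, hlB hz]; simpa using hpl.symm

end Big

/-! ## Graphs without a clique on four vertices -/

/-- No clique on four vertices. -/
def K4F {V : Type*} (G : SimpleGraph V) : Prop :=
  ∀ a b c d, G.Adj a b → G.Adj a c → G.Adj a d → G.Adj b c → G.Adj b d → G.Adj c d → False

/-- Neighbours on the 5-cycle: `b`, `e`. -/
def isT {V : Type*} (G : SimpleGraph V) (a b c d e x : V) : Prop :=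
  ¬ G.Adj x a ∧ G.Adj x b ∧ ¬ G.Adj x c ∧ ¬ G.Adj x d ∧ G.Adj x e

/-- Neighbours on the 5-cycle: `a`, `c`, `d`. -/
def isY {V : Type*} (G : SimpleGraph V) (a b c d e x : V) : Prop :=
  G.Adj x a ∧ ¬ G.Adj x b ∧ G.Adj x c ∧ G.Adj x d ∧ ¬ G.Adj x e

/-- Neighbours on the 5-cycle: all but `a`. -/
def isF {V : Type*} (G : SimpleGraph V) (a b c d e x : V) : Prop :=
  ¬ G.Adj x a ∧ G.Adj x b ∧ G.Adj x c ∧ G.Adj x d ∧ G.Adj x e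

/-- Adjacent to the whole 5-cycle. -/
def isV {V : Type*} (G : SimpleGraph V) (a b c d e x : V) : Prop :=
  G.Adj x a ∧ G.Adj x b ∧ G.Adj x c ∧ G.Adj x d ∧ G.Adj x e

/-- No neighbour on the 5-cycle. -/
def isZ {V : Type*} (G : SimpleGraph V) (a b c d e x : V) : Prop :=
  ¬ G.Adj x a ∧ ¬ G.Adj x b ∧ ¬ G.Adj x c ∧ ¬ G.Adj x d ∧ ¬ G.Adj x e

/-- A 5-wheel in a graph of our class. -/
structure Wh {V : Type*} (G : SimpleGraph V) (a b c d e h : V) : Prop where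
  p5 : P5F G
  t5 : T5F G
  k4 : K4F G
  cyc : C5 G a b c d e
  hub : isV G a b c d e h

section wheel
variable {V : Type*} {G : SimpleGraph V} {a b c d e h : V}

theorem C5.rot (w : C5 G a b c d e) : C5 G b c d e a := by
  obtain ⟨h1, h2, h3, h4, h5, h6, h7, h8, h9, h10⟩ := w
  exact ⟨h2, h3, h4, h5, h1, h7, h8, h9, h10, h6⟩

theorem isV.rot {x : V} (w : isV G a b c d e x) : isV G b c d e a x :=
  ⟨w.2.1, w.2.2.1, w.2.2.2.1, w.2.2.2.2, w.1⟩

theorem isZ.rot {x : V} (w : isZ G a b c d e x) : isZ G b c d e a x :=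
  ⟨w.2.1, w.2.2.1, w.2.2.2.1, w.2.2.2.2, w.1⟩

theorem Wh.rot (w : Wh G a b c d e h) : Wh G b c d e a h :=
  ⟨w.p5, w.t5, w.k4, w.cyc.rot, w.hub.rot⟩

theorem Wh.hY (w : Wh G a b c d e h) {x : V} (hx : isY G a b c d e x) : ¬ G.Adj h x := fun hh =>
  w.k4 h c d x w.hub.2.2.1 w.hub.2.2.2.1 hh w.cyc.2.2.1 hx.2.2.1.symm hx.2.2.2.1.symm

theorem Wh.hF (w : Wh G a b c d e h) {x : V} (hx : isF G a b c d e x) : ¬ G.Adj h x := fun hh =>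
  w.k4 h c d x w.hub.2.2.1 w.hub.2.2.2.1 hh w.cyc.2.2.1 hx.2.2.1.symm hx.2.2.2.1.symm

theorem Wh.hV (w : Wh G a b c d e h) {x : V} (hx : isV G a b c d e x) : ¬ G.Adj h x := fun hh =>
  w.k4 h c d x w.hub.2.2.1 w.hub.2.2.2.1 hh w.cyc.2.2.1 hx.2.2.1.symm hx.2.2.2.1.symm

theorem Wh.classify (w : Wh G a b c d e h) (x : V) :
    isZ G a b c d e x ∨ isV G a b c d e x ∨
    (isT G a b c d e x ∨ isT G b c d e a x ∨ isT G c d e a b x ∨ isT G d e a b c x ∨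
      isT G e a b c d x) ∨
    (isY G a b c d e x ∨ isY G b c d e a x ∨ isY G c d e a b x ∨ isY G d e a b c x ∨
      isY G e a b c d x) ∨
    (isF G a b c d e x ∨ isF G b c d e a x ∨ isF G c d e a b x ∨ isF G d e a b c x ∨
      isF G e a b c d x) := by
  have one : ∀ a b c d e, C5 G a b c d e → G.Adj x a → ¬ G.Adj x b → ¬ G.Adj x c →
      ¬ G.Adj x d → False := by
    rintro a b c d e ⟨h1, h2, h3, h4, h5, h6, h7, h8, h9, h10⟩ xa xb xc xd
    exact w.p5 x a b c d xa h1 h2 h3 xb xc xd h6 (fun k => h9 k.symm) h7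
  have three : ∀ a b c d e, C5 G a b c d e → G.Adj x e → G.Adj x a → G.Adj x b →
      ¬ G.Adj x c → ¬ G.Adj x d → False := fun a b c d e hc => w.t5 a b c d e x hc
  have c0 := w.cyc
  have c1 := c0.rot
  have c2 := c1.rot
  have c3 := c2.rot
  have c4 := c3.rot
  have o0 := one _ _ _ _ _ c0
  have o1 := one _ _ _ _ _ c1
  have o2 := one _ _ _ _ _ c2
  have o3 := one _ _ _ _ _ c3
  have o4 := one _ _ _ _ _ c4
  have t0 := three _ _ _ _ _ c0
  have t1 := three _ _ _ _ _ c1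
  have t2 := three _ _ _ _ _ c2
  have t3 := three _ _ _ _ _ c3
  have t4 := three _ _ _ _ _ c4
  clear one three c0 c1 c2 c3 c4 w
  unfold isZ isV isT isY isF
  by_cases xa : G.Adj x a <;> by_cases xb : G.Adj x b <;> by_cases xc : G.Adj x c <;>
    by_cases xd : G.Adj x d <;> by_cases xe : G.Adj x e <;> simp_all

theorem Wh.TT0 (w : Wh G a b c d e h) {x y : V} (hx : isT G a b c d e x) (hy : isT G a b c d e y) :
    ¬ G.Adj x y := by
  have k0 := w.t5 x b c d e y
  have k1 := w.k4 b h x y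
  have := G.adj_comm
  have := w.cyc
  have := w.hub
  grind [C5, isT, isY, isF, isV, isZ]

theorem Wh.XX2 (w : Wh G a b c d e h) {x y : V} (hx : isT G a b c d e x) (hy : isT G c d e a b y)
    (hhx : G.Adj h x) (hhy : G.Adj h y) :
    ¬ G.Adj x y := by
  have k0 := w.k4 b h x y
  have := G.adj_comm
  have := w.cyc
  have := w.hub
  grind [C5, isT, isY, isF, isV, isZ]

theorem Wh.TT1 (w : Wh G a b c d e h) {x y : V} (hx : isT G a b c d e x) (hy : isT G b c d e a y)
    (hhx : ¬ G.Adj h x) (hhy : ¬ G.Adj h y) :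
    False := by
  have k0 := w.p5 c y a e x
  have k1 := w.p5 d h a y x
  have := G.adj_comm
  have := w.cyc
  have := w.hub
  grind [C5, isT, isY, isF, isV, isZ]

theorem Wh.TT2 (w : Wh G a b c d e h) {x y : V} (hx : isT G a b c d e x) (hy : isT G c d e a b y)
    (hhx : ¬ G.Adj h x) (hhy : ¬ G.Adj h y) :
    ¬ G.Adj x y := by
  have k0 := w.p5 a h d y x
  have := G.adj_comm
  have := w.cyc
  have := w.hub
  grind [C5, isT, isY, isF, isV, isZ]

theorem Wh.TY1 (w : Wh G a b c d e h) {x y : V} (hx : isT G a b c d e x) (hy : isY G b c d e a y)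
    (hhx : ¬ G.Adj h x) :
    ¬ G.Adj x y := by
  have hhy := w.rot.hY hy
  have k0 := w.p5 a h d y x
  have := G.adj_comm
  have := w.cyc
  have := w.hub
  grind [C5, isT, isY, isF, isV, isZ]

theorem Wh.TY2 (w : Wh G a b c d e h) {x y : V} (hx : isT G a b c d e x) (hy : isY G c d e a b y)
    (hhx : ¬ G.Adj h x) :
    ¬ G.Adj x y := by
  have hhy := w.rot.rot.hY hy
  have k0 := w.p5 d h a y x
  have := G.adj_comm
  have := w.cyc
  have := w.hub
  grind [C5, isT, isY, isF, isV, isZ]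

theorem Wh.TY3 (w : Wh G a b c d e h) {x y : V} (hx : isT G a b c d e x) (hy : isY G d e a b c y)
    (hhx : ¬ G.Adj h x) :
    ¬ G.Adj x y := by
  have hhy := w.rot.rot.rot.hY hy
  have k0 := w.p5 c h a y x
  have := G.adj_comm
  have := w.cyc
  have := w.hub
  grind [C5, isT, isY, isF, isV, isZ]

theorem Wh.TY4 (w : Wh G a b c d e h) {x y : V} (hx : isT G a b c d e x) (hy : isY G e a b c d y)
    (hhx : ¬ G.Adj h x) :
    ¬ G.Adj x y := by
  have hhy := w.rot.rot.rot.rot.hY hy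
  have k0 := w.p5 a h c y x
  have := G.adj_comm
  have := w.cyc
  have := w.hub
  grind [C5, isT, isY, isF, isV, isZ]

theorem Wh.YY0 (w : Wh G a b c d e h) {x y : V} (hx : isY G a b c d e x) (hy : isY G a b c d e y) :
    ¬ G.Adj x y := by
  have hhx := w.hY hx
  have hhy := w.hY hy
  have k0 := w.k4 c d x y
  have := G.adj_comm
  have := w.cyc
  have := w.hub
  grind [C5, isT, isY, isF, isV, isZ]

theorem Wh.YY2 (w : Wh G a b c d e h) {x y : V} (hx : isY G a b c d e x) (hy : isY G c d e a b y) :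
    ¬ G.Adj x y := by
  have hhx := w.hY hx
  have hhy := w.rot.rot.hY hy
  have k0 := w.p5 b h d x y
  have := G.adj_comm
  have := w.cyc
  have := w.hub
  grind [C5, isT, isY, isF, isV, isZ]

theorem Wh.VV (w : Wh G a b c d e h) {x y : V} (hx : isV G a b c d e x) (hy : isV G a b c d e y) :
    ¬ G.Adj x y := by
  have hhx := w.hV hx
  have hhy := w.hV hy
  have k0 := w.k4 a b x y
  have := G.adj_comm
  have := w.cyc
  have := w.hub
  grind [C5, isT, isY, isF, isV, isZ]

theorem Wh.VF (w : Wh G a b c d e h) {x y : V} (hx : isV G a b c d e x) (hy : isF G a b c d e y) :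
    ¬ G.Adj x y := by
  have hhx := w.hV hx
  have hhy := w.hF hy
  have k0 := w.k4 b c x y
  have := G.adj_comm
  have := w.cyc
  have := w.hub
  grind [C5, isT, isY, isF, isV, isZ]

theorem Wh.FF0 (w : Wh G a b c d e h) {x y : V} (hx : isF G a b c d e x) (hy : isF G a b c d e y) :
    ¬ G.Adj x y := by
  have hhx := w.hF hx
  have hhy := w.hF hy
  have k0 := w.k4 b c x y
  have := G.adj_comm
  have := w.cyc
  have := w.hub
  grind [C5, isT, isY, isF, isV, isZ]

theorem Wh.FF1 (w : Wh G a b c d e h) {x y : V} (hx : isF G a b c d e x) (hy : isF G b c d e a y) :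
    ¬ G.Adj x y := by
  have hhx := w.hF hx
  have hhy := w.rot.hF hy
  have k0 := w.k4 c d x y
  have := G.adj_comm
  have := w.cyc
  have := w.hub
  grind [C5, isT, isY, isF, isV, isZ]

theorem Wh.FF2 (w : Wh G a b c d e h) {x y : V} (hx : isF G a b c d e x) (hy : isF G c d e a b y) :
    ¬ G.Adj x y := by
  have hhx := w.hF hx
  have hhy := w.rot.rot.hF hy
  have k0 := w.k4 d e x y
  have := G.adj_comm
  have := w.cyc
  have := w.hub
  grind [C5, isT, isY, isF, isV, isZ]

theorem Wh.FFx (w : Wh G a b c d e h) {x y : V} (hx : isF G a b c d e x) (hy : isF G c d e a b y) :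
    False := by
  have hhx := w.hF hx
  have hhy := w.rot.rot.hF hy
  have k0 := w.p5 x c h a y
  have k1 := w.k4 d e x y
  have := G.adj_comm
  have := w.cyc
  have := w.hub
  grind [C5, isT, isY, isF, isV, isZ]

theorem Wh.YV (w : Wh G a b c d e h) {x y : V} (hx : isY G a b c d e x) (hy : isV G a b c d e y) :
    ¬ G.Adj x y := by
  have hhx := w.hY hx
  have hhy := w.hV hy
  have k0 := w.k4 c d x y
  have := G.adj_comm
  have := w.cyc
  have := w.hub
  grind [C5, isT, isY, isF, isV, isZ]

theorem Wh.YF0 (w : Wh G a b c d e h) {x y : V} (hx : isY G a b c d e x) (hy : isF G a b c d e y) :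
    ¬ G.Adj x y := by
  have hhx := w.hY hx
  have hhy := w.hF hy
  have k0 := w.k4 c d x y
  have := G.adj_comm
  have := w.cyc
  have := w.hub
  grind [C5, isT, isY, isF, isV, isZ]

theorem Wh.YF1 (w : Wh G a b c d e h) {x y : V} (hx : isY G a b c d e x) (hy : isF G b c d e a y) :
    ¬ G.Adj x y := by
  have hhx := w.hY hx
  have hhy := w.rot.hF hy
  have k0 := w.k4 c d x y
  have := G.adj_comm
  have := w.cyc
  have := w.hub
  grind [C5, isT, isY, isF, isV, isZ]

theorem Wh.YF4 (w : Wh G a b c d e h) {x y : V} (hx : isY G a b c d e x) (hy : isF G e a b c d y) :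
    ¬ G.Adj x y := by
  have hhx := w.hY hx
  have hhy := w.rot.rot.rot.rot.hF hy
  have k0 := w.k4 c d x y
  have := G.adj_comm
  have := w.cyc
  have := w.hub
  grind [C5, isT, isY, isF, isV, isZ]

theorem Wh.ZT (w : Wh G a b c d e h) {x y : V} (hx : isZ G a b c d e x) (hy : isT G a b c d e y) :
    ¬ G.Adj x y := by
  have k0 := w.p5 c d e y x
  have := G.adj_comm
  have := w.cyc
  have := w.hub
  grind [C5, isT, isY, isF, isV, isZ]

theorem Wh.ZY (w : Wh G a b c d e h) {x y : V} (hx : isZ G a b c d e x) (hy : isY G a b c d e y)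
    (hhx : ¬ G.Adj h x) :
    ¬ G.Adj x y := by
  have hhy := w.hY hy
  have k0 := w.p5 b h d y x
  have := G.adj_comm
  have := w.cyc
  have := w.hub
  grind [C5, isT, isY, isF, isV, isZ]

theorem Wh.ZF (w : Wh G a b c d e h) {x y : V} (hx : isZ G a b c d e x) (hy : isF G a b c d e y)
    (hhx : ¬ G.Adj h x) :
    ¬ G.Adj x y := by
  have hhy := w.hF hy
  have k0 := w.p5 a h c y x
  have := G.adj_comm
  have := w.cyc
  have := w.hub
  grind [C5, isT, isY, isF, isV, isZ]

end wheel

/-! ## Colouring graphs without a clique on four vertices -/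

section kfour
variable {V : Type*} {G : SimpleGraph V}

theorem K4F.triFree (hk : K4F G) (p : V) {S : Set V} (hS : ∀ x ∈ S, G.Adj p x) : TriFree G S :=
  fun x hx y hy z hz hxy hyz hxz => hk p x y z (hS x hx) (hS y hy) (hS z hz) hxy hxz hyz

theorem nowheel_color (hP : P5F G) (hk : K4F G) {U : Set V} (hU : Conn G U)
    (hw : ∀ a b c d e h, C5 G a b c d e → ¬ isV G a b c d e h) :
    ∃ f : V → ℕ, PropOn G U f ∧ ∀ x ∈ U, f x < 6 := by
  classical
  have nb : ∀ (p : V) (S : Set V), (∀ x ∈ S, G.Adj p x) →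
      ∃ f : V → ℕ, PropOn G S f ∧ ∀ x ∈ S, f x < 2 := fun p S hS =>
    tf_bip hP (hk.triFree p hS) (fun a ha b hb c hc d hd e he h5 =>
      hw a b c d e p h5 ⟨hS a ha, hS b hb, hS c hc, hS d hd, hS e he⟩)
  by_cases hne : ∃ v, v ∈ U
  swap
  · exact ⟨fun _ => 0, fun x hx => (hne ⟨x, hx⟩).elim, fun x hx => (hne ⟨x, hx⟩).elim⟩
  obtain ⟨v, hv⟩ := hne
  obtain ⟨f0, h0, h0'⟩ := nb v {x | x ∈ U ∧ G.Adj v x} (fun x hx => hx.2)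
  obtain ⟨f1, h1, h1'⟩ := comp_color (G := G) {x | x ∈ U ∧ x ≠ v ∧ ¬ G.Adj v x}
    (fun _ k => 2 ≤ k ∧ k < 6) (by
    intro x hx
    set D := cmpt G {x | x ∈ U ∧ x ≠ v ∧ ¬ G.Adj v x} x with hD
    have hDs : ∀ z ∈ D, z ∈ U ∧ z ≠ v ∧ ¬ G.Adj v z := fun z hz => cmpt_sub hx hz
    have hDc : Conn G D := conn_cmpt hx
    obtain ⟨d, hd, u, hu, huR, hud⟩ := exit_comp (hU x hx.1 v hv) hx (fun h => h.2.1 rfl)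
    have huv : G.Adj v u := by
      by_contra hcon
      refine huR ⟨hu, ?_, hcon⟩
      rintro rfl
      exact (hDs d hd).2.2 hud
    obtain ⟨g0, k0, k0'⟩ := nb u {x | x ∈ D ∧ G.Adj u x} (fun x hx => hx.2)
    obtain ⟨g1, k1, k1'⟩ := comp_color (G := G) {x | x ∈ D ∧ ¬ G.Adj u x} (fun _ k => k < 2) (by
      intro t ht
      obtain ⟨w, hw1, hw2, hw3⟩ := step_ex hP hDc huv (fun d hd => (hDs d hd).2.2) hd hud ht.1 ht.2
      exact nb w _ hw3)
    refine ⟨fun y => if G.Adj u y then g0 y + 2 else g1 y + 4, ?_, ?_⟩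
    · intro y hy z hz hyz
      by_cases a1 : G.Adj u y <;> by_cases a2 : G.Adj u z <;> simp only [a1, a2, if_true, if_false]
      · have := k0 y ⟨hy, a1⟩ z ⟨hz, a2⟩ hyz
        omega
      · have := k0' y ⟨hy, a1⟩
        omega
      · have := k0' z ⟨hz, a2⟩
        omega
      · have := k1 y ⟨hy, a1⟩ z ⟨hz, a2⟩ hyz
        omega
    · intro y hy
      by_cases a1 : G.Adj u y <;> simp only [a1, if_true, if_false]
      · have := k0' y ⟨hy, a1⟩
        omega
      · have := (k1' y ⟨hy, a1⟩ : g1 y < 2)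
        omega)
  refine ⟨fun y => if G.Adj v y then f0 y else if y = v then 2 else f1 y, ?_, ?_⟩
  · intro y hy z hz hyz
    by_cases a1 : G.Adj v y <;> by_cases a2 : G.Adj v z <;> simp only [a1, a2, if_true, if_false]
    · exact h0 y ⟨hy, a1⟩ z ⟨hz, a2⟩ hyz
    · have := h0' y ⟨hy, a1⟩
      split_ifs with e1
      · omega
      · have := (h1' z ⟨hz, e1, a2⟩ : 2 ≤ f1 z ∧ _)
        omega
    · have := h0' z ⟨hz, a2⟩
      split_ifs with e1
      · omega
      · have := (h1' y ⟨hy, e1, a1⟩ : 2 ≤ f1 y ∧ _)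
        omega
    · have e1 : y ≠ v := by
        rintro rfl
        exact a2 hyz
      have e2 : z ≠ v := by
        rintro rfl
        exact a1 hyz.symm
      simp only [e1, e2, if_false]
      exact h1 y ⟨hy, e1, a1⟩ z ⟨hz, e2, a2⟩ hyz
  · intro y hy
    by_cases a1 : G.Adj v y <;> simp only [a1, if_true, if_false]
    · have := h0' y ⟨hy, a1⟩
      omega
    · split_ifs with e1
      · omega
      · exact (h1' y ⟨hy, e1, a1⟩).2

/-- Colouring a component of the vertices without neighbours on the 5-cycle. -/
theorem zcol_comp (hP : P5F G) (hT : T5F G) (hk : K4F G) {E : Set V} (hE : Conn G E) {a v d0 : V}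
    (hav : G.Adj a v) (haE : ∀ y ∈ E, ¬ G.Adj a y) (hd0 : d0 ∈ E) (hvd : G.Adj v d0) :
    ∃ f : V → ℕ, PropOn G E f ∧ ∀ y ∈ E, f y < 6 ∧ f y ≠ 3 ∧ (G.Adj v y → f y < 3) := by
  classical
  obtain ⟨g, g1, g2, g3⟩ := tf_color hP (S := {y | y ∈ E ∧ G.Adj v y})
    (hk.triFree v (fun x hx => hx.2))
  obtain ⟨f, f1, f2⟩ := comp_color (G := G) {y | y ∈ E ∧ ¬ G.Adj v y}
    (fun y k => k < 6 ∧ k ≠ 3 ∧ ∀ s ∈ E, G.Adj v s → G.Adj s y → g s ≠ k) (by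
    intro t0 ht0
    set E' := cmpt G {y | y ∈ E ∧ ¬ G.Adj v y} t0 with hE'
    have hsub : E' ⊆ {y | y ∈ E ∧ ¬ G.Adj v y} := cmpt_sub ht0
    have hc : Conn G E' := conn_cmpt ht0
    have hall : ∀ s ∈ E, G.Adj v s → ∀ y ∈ E', G.Adj s y → ∀ y' ∈ E', G.Adj s y' := by
      intro s hs hvs y hy hsy y' hy'
      refine step_all hP hav haE hs hvs (t := y) (t' := y') ?_ hsy
      exact Rch.trans (Rch.symm hy) hy'
    by_cases hed : ∃ t ∈ E', ∃ t' ∈ E', G.Adj t t'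
    swap
    · push Not at hed
      refine ⟨fun _ => 4, fun x hx y hy hxy => (hed x hx y hy hxy).elim, fun y hy => ?_⟩
      refine ⟨(by omega : 4 < 6), (by omega : 4 ≠ 3), fun s hs hvs hsy => ?_⟩
      have := g2 s ⟨hs, hvs⟩
      show g s ≠ 4
      omega
    obtain ⟨t, ht, t', ht', htt⟩ := hed
    obtain ⟨w, hw1, hw2, hw3⟩ := step_ex hP hE hav haE hd0 hvd ht0.1 ht0.2
    obtain ⟨p, p1, p2, -⟩ := tf_color hP (hk.triFree w hw3)
    have hmiss : ∃ m : ℕ, (m = 0 ∨ m = 2) ∧ ∀ s ∈ E, G.Adj v s → G.Adj s t → g s ≠ m := by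
      by_contra hcon
      push Not at hcon
      obtain ⟨b, hb, hvb, hbt, gb⟩ := hcon 2 (Or.inr rfl)
      obtain ⟨c, hc, hvc, hct, gc⟩ := hcon 0 (Or.inl rfl)
      have ind : ∀ s ∈ E, G.Adj v s → ∀ s' ∈ E, G.Adj v s' → G.Adj s t → G.Adj s' t →
          ¬ G.Adj s s' := fun s hs hvs s' hs' hvs' h1 h2 h3 =>
        hk s s' t t' h3 h1 (hall s hs hvs t ht h1 t' ht') h2 (hall s' hs' hvs' t ht h2 t' ht') htt
      have hbc := ind b hb hvb c hc hvc hbt hct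
      obtain ⟨x, ⟨hx, hvx⟩, y, ⟨hy, hvy⟩, hxb, hxc, hyc, hyb⟩ := g3 b ⟨hb, hvb⟩ c ⟨hc, hvc⟩ gb gc hbc
      have hxt : ¬ G.Adj x t := fun h => ind x hx hvx b hb hvb h hbt hxb
      have hyt : ¬ G.Adj y t := fun h => ind y hy hvy c hc hvc h hct hyc
      by_cases hxy : G.Adj x y
      · refine hT t b x y c t' ⟨hbt.symm, hxb.symm, hxy, hyc, hct, fun h => hxt h.symm,
          fun h => hyb h.symm, hxc, hyt, fun h => hbc h.symm⟩
          (hall c hc hvc t ht hct t' ht').symm htt.symm (hall b hb hvb t ht hbt t' ht').symm ?_ ?_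
        · exact fun h => hxt (hall x hx hvx t' ht' h.symm t ht)
        · exact fun h => hyt (hall y hy hvy t' ht' h.symm t ht)
      · exact hP x b t c y hxb hbt hct.symm hyc.symm hxt hxc hxy hbc (fun h => hyb h.symm)
          (fun h => hyt h.symm)
    obtain ⟨m, hm, hm'⟩ := hmiss
    refine ⟨fun y => if p y = 2 then m else p y + 4, ?_, ?_⟩
    · intro x hx y hy hxy
      have := p1 x hx y hy hxy
      show (if p x = 2 then m else p x + 4) ≠ (if p y = 2 then m else p y + 4)
      split_ifs <;> omega
    · intro y hy
      have := p2 y hy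
      refine ⟨?_, ?_, fun s hs hvs hsy => ?_⟩
      · show (if p y = 2 then m else p y + 4) < 6
        split_ifs <;> omega
      · show (if p y = 2 then m else p y + 4) ≠ 3
        split_ifs <;> omega
      · have h1 := g2 s ⟨hs, hvs⟩
        have h2 := hm' s hs hvs (hall s hs hvs y hy hsy t ht)
        show g s ≠ (if p y = 2 then m else p y + 4)
        split_ifs <;> omega)
  refine ⟨fun y => if G.Adj v y then g y else f y, ?_, ?_⟩
  · intro y hy z hz hyz
    by_cases a1 : G.Adj v y <;> by_cases a2 : G.Adj v z <;> simp only [a1, a2, if_true, if_false]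
    · exact g1 y ⟨hy, a1⟩ z ⟨hz, a2⟩ hyz
    · exact (f2 z ⟨hz, a2⟩).2.2 y hy a1 hyz
    · exact fun h => (f2 y ⟨hy, a1⟩).2.2 z hz a2 hyz.symm h.symm
    · exact f1 y ⟨hy, a1⟩ z ⟨hz, a2⟩ hyz
  · intro y hy
    by_cases a1 : G.Adj v y
    · have := g2 y ⟨hy, a1⟩
      simp only [a1, if_true]
      refine ⟨?_, ?_, fun _ => ?_⟩ <;> omega
    · simp only [a1, if_false]
      have := f2 y ⟨hy, a1⟩
      exact ⟨this.1, this.2.1, fun h => h.elim⟩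

end kfour

/-! ## Colouring around a 5-wheel -/

section wheelcolor
variable {V : Type*} {G : SimpleGraph V} {a b c d e h : V}

/-- Colour classes of the vertices with a neighbour on the 5-cycle. -/
def Cl {V : Type*} (G : SimpleGraph V) (a b c d e h : V) (k : ℕ) (x : V) : Prop :=
  (k = 0 ∧ G.Adj h x ∧ (isT G a b c d e x ∨ isT G c d e a b x)) ∨
  (k = 1 ∧ G.Adj h x ∧ (isT G b c d e a x ∨ isT G d e a b c x)) ∨
  (k = 2 ∧ G.Adj h x ∧ isT G e a b c d x) ∨
  (k = 3 ∧ (isV G a b c d e x ∨ isF G a b c d e x ∨ isF G b c d e a x ∨ isF G e a b c d x ∨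
    isY G a b c d e x)) ∨
  (k = 4 ∧ (isY G b c d e a x ∨ isY G d e a b c x ∨ (¬ G.Adj h x ∧
    (isT G a b c d e x ∨ isT G c d e a b x ∨ isT G e a b c d x)))) ∨
  (k = 5 ∧ (isY G c d e a b x ∨ isY G e a b c d x ∨ (¬ G.Adj h x ∧
    (isT G b c d e a x ∨ isT G d e a b c x))))

theorem Wh.cl_ex (w : Wh G a b c d e h) (h2 : ∀ x, ¬ isF G c d e a b x)
    (h3 : ∀ x, ¬ isF G d e a b c x) {x : V} (hx : ¬ isZ G a b c d e x) :
    ∃ k, Cl G a b c d e h k x := by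
  have q2 := h2 x
  have q3 := h3 x
  have := w.classify x
  by_cases hh : G.Adj h x
  · rcases this with k | k | (k | k | k | k | k) | (k | k | k | k | k) | (k | k | k | k | k)
    · exact (hx k).elim
    · exact ⟨3, by simp [Cl, k, hh]⟩
    · exact ⟨0, by simp [Cl, k, hh]⟩
    · exact ⟨1, by simp [Cl, k, hh]⟩
    · exact ⟨0, by simp [Cl, k, hh]⟩
    · exact ⟨1, by simp [Cl, k, hh]⟩
    · exact ⟨2, by simp [Cl, k, hh]⟩
    · exact ⟨3, by simp [Cl, k, hh]⟩
    · exact ⟨4, by simp [Cl, k, hh]⟩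
    · exact ⟨5, by simp [Cl, k, hh]⟩
    · exact ⟨4, by simp [Cl, k, hh]⟩
    · exact ⟨5, by simp [Cl, k, hh]⟩
    all_goals first | exact (q2 k).elim | exact (q3 k).elim | exact ⟨3, by simp [Cl, k, hh]⟩
  · rcases this with k | k | (k | k | k | k | k) | (k | k | k | k | k) | (k | k | k | k | k)
    · exact (hx k).elim
    · exact ⟨3, by simp [Cl, k, hh]⟩
    · exact ⟨4, by simp [Cl, k, hh]⟩
    · exact ⟨5, by simp [Cl, k, hh]⟩
    · exact ⟨4, by simp [Cl, k, hh]⟩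
    · exact ⟨5, by simp [Cl, k, hh]⟩
    · exact ⟨4, by simp [Cl, k, hh]⟩
    · exact ⟨3, by simp [Cl, k, hh]⟩
    · exact ⟨4, by simp [Cl, k, hh]⟩
    · exact ⟨5, by simp [Cl, k, hh]⟩
    · exact ⟨4, by simp [Cl, k, hh]⟩
    · exact ⟨5, by simp [Cl, k, hh]⟩
    all_goals first | exact (q2 k).elim | exact (q3 k).elim | exact ⟨3, by simp [Cl, k, hh]⟩

theorem Cl.lt {k : ℕ} {x : V} (hx : Cl G a b c d e h k x) : k < 6 := by
  unfold Cl at hx; omega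

theorem Wh.cl_ind (w : Wh G a b c d e h) {k : ℕ} {x y : V} (hx : Cl G a b c d e h k x)
    (hy : Cl G a b c d e h k y) : ¬ G.Adj x y := by
  intro hxy
  have w1 := w.rot
  have w2 := w1.rot
  have w3 := w2.rot
  have w4 := w3.rot
  have yx := hxy.symm
  rcases hx with ⟨rfl, hx⟩ | ⟨rfl, hx⟩ | ⟨rfl, hx⟩ | ⟨rfl, hx⟩ | ⟨rfl, hx⟩ | ⟨rfl, hx⟩
  · have hy : G.Adj h y ∧ (isT G a b c d e y ∨ isT G c d e a b y) := by
      simpa [Cl] using hy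
    obtain ⟨p, hx⟩ := hx
    obtain ⟨q, hy⟩ := hy
    rcases hx with hx | hx <;> rcases hy with hy | hy
    · exact w.TT0 hx hy hxy
    · exact w.XX2 hx hy p q hxy
    · exact w.XX2 hy hx q p yx
    · exact w2.TT0 hx hy hxy
  · have hy : G.Adj h y ∧ (isT G b c d e a y ∨ isT G d e a b c y) := by
      simpa [Cl] using hy
    obtain ⟨p, hx⟩ := hx
    obtain ⟨q, hy⟩ := hy
    rcases hx with hx | hx <;> rcases hy with hy | hy
    · exact w1.TT0 hx hy hxy
    · exact w1.XX2 hx hy p q hxy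
    · exact w1.XX2 hy hx q p yx
    · exact w3.TT0 hx hy hxy
  · have hy : G.Adj h y ∧ isT G e a b c d y := by
      simpa [Cl] using hy
    exact w4.TT0 hx.2 hy.2 hxy
  · have hy : (isV G a b c d e y ∨ isF G a b c d e y ∨ isF G b c d e a y ∨ isF G e a b c d y ∨
        isY G a b c d e y) := by
      simpa [Cl] using hy
    have vr : ∀ {z}, isV G a b c d e z → isV G e a b c d z := fun hz => hz.rot.rot.rot.rot
    rcases hx with hx | hx | hx | hx | hx <;> rcases hy with hy | hy | hy | hy | hy
    · exact w.VV hx hy hxy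
    · exact w.VF hx hy hxy
    · exact w1.VF hx.rot hy hxy
    · exact w4.VF (vr hx) hy hxy
    · exact w.YV hy hx yx
    · exact w.VF hy hx yx
    · exact w.FF0 hx hy hxy
    · exact w.FF1 hx hy hxy
    · exact w4.FF1 hy hx yx
    · exact w.YF0 hy hx yx
    · exact w1.VF hy.rot hx yx
    · exact w.FF1 hy hx yx
    · exact w1.FF0 hx hy hxy
    · exact w4.FF2 hy hx yx
    · exact w.YF1 hy hx yx
    · exact w4.VF (vr hy) hx yx
    · exact w4.FF1 hx hy hxy
    · exact w4.FF2 hx hy hxy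
    · exact w4.FF0 hx hy hxy
    · exact w.YF4 hy hx yx
    · exact w.YV hx hy hxy
    · exact w.YF0 hx hy hxy
    · exact w.YF1 hx hy hxy
    · exact w.YF4 hx hy hxy
    · exact w.YY0 hx hy hxy
  · have hy : (isY G b c d e a y ∨ isY G d e a b c y ∨ (¬ G.Adj h y ∧
        (isT G a b c d e y ∨ isT G c d e a b y ∨ isT G e a b c d y))) := by
      simpa [Cl] using hy
    rcases hx with hx | hx | ⟨p, hx | hx | hx⟩ <;> rcases hy with hy | hy | ⟨q, hy | hy | hy⟩
    · exact w1.YY0 hx hy hxy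
    · exact w1.YY2 hx hy hxy
    · exact w.TY1 hy hx q yx
    · exact w2.TY4 hy hx q yx
    · exact w4.TY2 hy hx q yx
    · exact w1.YY2 hy hx yx
    · exact w3.YY0 hx hy hxy
    · exact w.TY3 hy hx q yx
    · exact w2.TY1 hy hx q yx
    · exact w4.TY4 hy hx q yx
    · exact w.TY1 hx hy p hxy
    · exact w.TY3 hx hy p hxy
    · exact w.TT0 hx hy hxy
    · exact w.TT2 hx hy p q hxy
    · exact w4.TT1 hy hx q p
    · exact w2.TY4 hx hy p hxy
    · exact w2.TY1 hx hy p hxy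
    · exact w.TT2 hy hx q p yx
    · exact w2.TT0 hx hy hxy
    · exact w2.TT2 hx hy p q hxy
    · exact w4.TY2 hx hy p hxy
    · exact w4.TY4 hx hy p hxy
    · exact w4.TT1 hx hy p q
    · exact w2.TT2 hy hx q p yx
    · exact w4.TT0 hx hy hxy
  · have hy : (isY G c d e a b y ∨ isY G e a b c d y ∨ (¬ G.Adj h y ∧
        (isT G b c d e a y ∨ isT G d e a b c y))) := by
      simpa [Cl] using hy
    rcases hx with hx | hx | ⟨p, hx | hx⟩ <;> rcases hy with hy | hy | ⟨q, hy | hy⟩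
    · exact w2.YY0 hx hy hxy
    · exact w2.YY2 hx hy hxy
    · exact w1.TY1 hy hx q yx
    · exact w3.TY4 hy hx q yx
    · exact w2.YY2 hy hx yx
    · exact w4.YY0 hx hy hxy
    · exact w1.TY3 hy hx q yx
    · exact w3.TY1 hy hx q yx
    · exact w1.TY1 hx hy p hxy
    · exact w1.TY3 hx hy p hxy
    · exact w1.TT0 hx hy hxy
    · exact w1.TT2 hx hy p q hxy
    · exact w3.TY4 hx hy p hxy
    · exact w3.TY1 hx hy p hxy
    · exact w1.TT2 hy hx q p yx
    · exact w3.TT0 hx hy hxy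

/-- A neighbour of a vertex off the cycle is not of type `T`. -/
theorem Wh.z_nbr (w : Wh G a b c d e h) {z y : V} (hz : isZ G a b c d e z) (hzy : G.Adj z y) :
    ¬ (isT G a b c d e y ∨ isT G b c d e a y ∨ isT G c d e a b y ∨ isT G d e a b c y ∨
      isT G e a b c d y) := by
  rintro (k | k | k | k | k)
  · exact w.ZT hz k hzy
  · exact w.rot.ZT hz.rot k hzy
  · exact w.rot.rot.ZT hz.rot.rot k hzy
  · exact w.rot.rot.rot.ZT hz.rot.rot.rot k hzy
  · exact w.rot.rot.rot.rot.ZT hz.rot.rot.rot.rot k hzy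

theorem Wh.z_nbr' (w : Wh G a b c d e h) {z y : V} (hz : isZ G a b c d e z)
    (hy : ¬ isZ G a b c d e y) (hh : ¬ G.Adj h z) (hzy : G.Adj z y) : isV G a b c d e y := by
  rcases w.classify y with k | k | k | (k | k | k | k | k) | (k | k | k | k | k)
  · exact (hy k).elim
  · exact k
  · exact (w.z_nbr hz hzy k).elim
  · exact (w.ZY hz k hh hzy).elim
  · exact (w.rot.ZY hz.rot k hh hzy).elim
  · exact (w.rot.rot.ZY hz.rot.rot k hh hzy).elim
  · exact (w.rot.rot.rot.ZY hz.rot.rot.rot k hh hzy).elim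
  · exact (w.rot.rot.rot.rot.ZY hz.rot.rot.rot.rot k hh hzy).elim
  · exact (w.ZF hz k hh hzy).elim
  · exact (w.rot.ZF hz.rot k hh hzy).elim
  · exact (w.rot.rot.ZF hz.rot.rot k hh hzy).elim
  · exact (w.rot.rot.rot.ZF hz.rot.rot.rot k hh hzy).elim
  · exact (w.rot.rot.rot.rot.ZF hz.rot.rot.rot.rot k hh hzy).elim

theorem cl_V {k : ℕ} {x : V} (hx : Cl G a b c d e h k x) (hv : isV G a b c d e x) : k = 3 := by
  obtain ⟨v1, v2, v3, v4, v5⟩ := hv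
  unfold Cl isV isT isY isF at hx
  simp only [v1, v2, v3, v4, v5, not_true, and_false, or_false, false_or,
    and_true] at hx
  omega

theorem cl_nT {k : ℕ} {x : V} (hx : Cl G a b c d e h k x)
    (ht : ¬ (isT G a b c d e x ∨ isT G b c d e a x ∨ isT G c d e a b x ∨ isT G d e a b c x ∨
      isT G e a b c d x)) : 3 ≤ k := by
  rcases hx with ⟨rfl, -, hx⟩ | ⟨rfl, -, hx⟩ | ⟨rfl, -, hx⟩ | ⟨rfl, -⟩ | ⟨rfl, -⟩ | ⟨rfl, -⟩
  · exact (ht (hx.elim Or.inl fun k => Or.inr (Or.inr (Or.inl k)))).elim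
  · exact (ht (hx.elim (fun k => Or.inr (Or.inl k))
      fun k => Or.inr (Or.inr (Or.inr (Or.inl k))))).elim
  · exact (ht (Or.inr (Or.inr (Or.inr (Or.inr hx))))).elim
  all_goals omega

theorem Wh.color0 (w : Wh G a b c d e h) {U : Set V} (hU : Conn G U) (ha : a ∈ U)
    (h2 : ∀ x, ¬ isF G c d e a b x) (h3 : ∀ x, ¬ isF G d e a b c x) :
    ∃ f : V → ℕ, PropOn G U f ∧ ∀ x ∈ U, f x < 6 := by
  classical
  have hcl : ∀ x, ∃ k, ¬ isZ G a b c d e x → Cl G a b c d e h k x := by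
    intro x
    by_cases hx : isZ G a b c d e x
    · exact ⟨0, fun h => (h hx).elim⟩
    · obtain ⟨k, hk⟩ := w.cl_ex h2 h3 hx
      exact ⟨k, fun _ => hk⟩
  choose g hg using hcl
  obtain ⟨f, f1, f2⟩ := comp_color (G := G) {x | x ∈ U ∧ isZ G a b c d e x}
    (fun y k => k < 6 ∧ k ≠ 3 ∧ (G.Adj h y → k < 3)) (by
    intro x hx
    set E := cmpt G {x | x ∈ U ∧ isZ G a b c d e x} x with hE
    have hEs : ∀ z ∈ E, z ∈ U ∧ isZ G a b c d e z := fun z hz => cmpt_sub hx hz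
    have hEc : Conn G E := conn_cmpt hx
    by_cases hh : ∃ y ∈ E, G.Adj h y
    · obtain ⟨y, hy, hhy⟩ := hh
      exact zcol_comp w.p5 w.t5 w.k4 hEc w.hub.1.symm (fun y hy h => (hEs y hy).2.1 h.symm) hy hhy
    · push Not at hh
      obtain ⟨y, hy, u, hu, huR, huy⟩ := exit_comp (hU x hx.1 a ha) hx
        (fun h => h.2.2.1 w.cyc.1)
      have huv : isV G a b c d e u := w.z_nbr' (hEs y hy).2 (fun h => huR ⟨hu, h⟩) (hh y hy) huy.symm
      obtain ⟨f, f1, f2⟩ := zcol_comp w.p5 w.t5 w.k4 hEc huv.1.symm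
        (fun y hy h => (hEs y hy).2.1 h.symm) hy huy
      exact ⟨f, f1, fun z hz => ⟨(f2 z hz).1, (f2 z hz).2.1, fun h => (hh z hz h).elim⟩⟩)
  have cross : ∀ z ∈ U, isZ G a b c d e z → ∀ y, ¬ isZ G a b c d e y → G.Adj z y → f z ≠ g y := by
    intro z hzU hz y hy hzy
    obtain ⟨-, k2, k3⟩ := f2 z ⟨hzU, hz⟩
    by_cases hh : G.Adj h z
    · have := cl_nT (hg y hy) (w.z_nbr hz hzy)
      have := k3 hh
      omega
    · have := cl_V (hg y hy) (w.z_nbr' hz hy hh hzy)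
      omega
  refine ⟨fun y => if isZ G a b c d e y then f y else g y, ?_, ?_⟩
  · intro y hy z hz hyz
    by_cases a1 : isZ G a b c d e y <;> by_cases a2 : isZ G a b c d e z <;>
      simp only [a1, a2, if_true, if_false]
    · exact f1 y ⟨hy, a1⟩ z ⟨hz, a2⟩ hyz
    · exact cross y hy a1 z a2 hyz
    · exact (cross z hz a2 y a1 hyz.symm).symm
    · intro heq
      have q1 := hg y a1
      have q2 := hg z a2
      rw [← heq] at q2
      exact w.cl_ind q1 q2 hyz
  · intro y hy
    by_cases a1 : isZ G a b c d e y <;> simp only [a1, if_true, if_false]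
    · exact (f2 y ⟨hy, a1⟩).1
    · exact (hg y a1).lt

theorem Wh.color1 (w : Wh G a b c d e h) {U : Set V} (hU : Conn G U) (ha : a ∈ U)
    {x : V} (hx : isF G a b c d e x) :
    ∃ f : V → ℕ, PropOn G U f ∧ ∀ x ∈ U, f x < 6 :=
  w.color0 hU ha (fun _ hy => w.FFx hx hy) (fun _ hy => w.rot.rot.rot.FFx hy hx)

theorem Wh.color (w : Wh G a b c d e h) {U : Set V} (hU : Conn G U)
    (hin : ∀ x y, G.Adj x y → x ∈ U) :
    ∃ f : V → ℕ, PropOn G U f ∧ ∀ x ∈ U, f x < 6 := by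
  have c0 := w.cyc
  by_cases k0 : ∃ x, isF G a b c d e x
  · exact k0.elim fun x hx => w.color1 hU (hin _ _ c0.1) hx
  by_cases k1 : ∃ x, isF G b c d e a x
  · exact k1.elim fun x hx => w.rot.color1 hU (hin _ _ c0.2.1) hx
  by_cases k2 : ∃ x, isF G c d e a b x
  · exact k2.elim fun x hx => w.rot.rot.color1 hU (hin _ _ c0.2.2.1) hx
  by_cases k3 : ∃ x, isF G d e a b c x
  · exact k3.elim fun x hx => w.rot.rot.rot.color1 hU (hin _ _ c0.2.2.2.1) hx
  push Not at k2 k3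
  exact w.color0 hU (hin _ _ c0.1) k2 k3

end wheelcolor

theorem k4free_color {V : Type*} {G : SimpleGraph V} (hP : P5F G) (hT : T5F G) (hk : K4F G)
    {U : Set V} (hU : Conn G U) (hin : ∀ x y, G.Adj x y → x ∈ U) :
    ∃ f : V → ℕ, PropOn G U f ∧ ∀ x ∈ U, f x < 6 := by
  by_cases h : ∃ a b c d e h, C5 G a b c d e ∧ isV G a b c d e h
  · obtain ⟨a, b, c, d, e, h, h1, h2⟩ := h
    exact Wh.color ⟨hP, hT, hk, h1, h2⟩ hU hin
  · exact nowheel_color hP hk hU (fun a b c d e x h1 h2 => h ⟨a, b, c, d, e, x, h1, h2⟩)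

/-! ## Assembly -/

theorem contains_of_iff {V W : Type*} {G : SimpleGraph V} {H : SimpleGraph W} (f : W → V)
    (htw : ∀ i j, (∀ k, H.Adj i k ↔ H.Adj j k) → i = j)
    (hf : ∀ i j, H.Adj i j ↔ G.Adj (f i) (f j)) : ContainsInduced G H :=
  ⟨⟨f, fun i j hij => htw i j (fun k => by rw [hf, hf, hij])⟩, hf⟩

theorem p5f_of_free {V : Type*} {G : SimpleGraph V} (h : InducedFree G (pathGraph 5)) : P5F G := by
  intro a b c d e h1 h2 h3 h4 h5 h6 h7 h8 h9 h10
  refine h (contains_of_iff ![a, b, c, d, e] ?_ ?_)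
  · simp only [pathGraph_adj]
    decide
  · intro i j
    have := G.adj_comm
    fin_cases i <;> fin_cases j <;> simp [pathGraph_adj, *]

theorem hvnf_of_free {V : Type*} {G : SimpleGraph V} (h : InducedFree G hvnGraph) : HVNF G := by
  intro a b c d e h1 h2 h3 h4 h5 h6 h7 h8 h9 h10
  refine h (contains_of_iff ![a, b, c, d, e] ?_ ?_)
  · simp only [hvnGraph, SimpleGraph.fromEdgeSet_adj, Set.mem_insert_iff, Set.mem_singleton_iff]
    decide
  · intro i j
    have := G.adj_comm
    fin_cases i <;> fin_cases j <;> simp [hvnGraph, SimpleGraph.fromEdgeSet_adj, *] <;>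
      (rw [G.adj_comm]; assumption)

theorem t5f_of_free {V : Type*} {G : SimpleGraph V} (h : InducedFree G t5WheelGraph) : T5F G := by
  rintro a b c d e x ⟨h1, h2, h3, h4, h5, h6, h7, h8, h9, h10⟩ k1 k2 k3 k4 k5
  refine h (contains_of_iff ![a, b, c, d, e, x] ?_ ?_)
  · simp only [t5WheelGraph, SimpleGraph.fromEdgeSet_adj, Set.mem_insert_iff,
      Set.mem_singleton_iff]
    decide
  · intro i j
    have := G.adj_comm
    fin_cases i <;> fin_cases j <;>
      simp [t5WheelGraph, SimpleGraph.fromEdgeSet_adj, *] <;>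
      (rw [G.adj_comm]; assumption)

/-- The subgraph of `G` with all edges inside `U`. -/
def resG {V : Type*} (G : SimpleGraph V) (U : Set V) : SimpleGraph V where
  Adj x y := G.Adj x y ∧ x ∈ U ∧ y ∈ U
  symm := ⟨fun _ _ h => ⟨h.1.symm, h.2.2, h.2.1⟩⟩
  loopless := ⟨fun _ h => G.loopless.irrefl _ h.1⟩

theorem small_color {V : Type*} {G : SimpleGraph V} (hP : P5F G) (hT : T5F G) {U : Set V}
    (hU : Conn G U) (h3 : CliqueLe G U 3) :
    ∃ f : V → ℕ, PropOn G U f ∧ ∀ x ∈ U, f x < 6 := by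
  classical
  have up : ∀ {x y}, x ∈ U → y ∈ U → ¬ (resG G U).Adj x y → ¬ G.Adj x y :=
    fun hx hy h k => h ⟨k, hx, hy⟩
  suffices key : ∃ f : V → ℕ, PropOn (resG G U) U f ∧ ∀ x ∈ U, f x < 6 by
    obtain ⟨f, f1, f2⟩ := key
    exact ⟨f, fun x hx y hy hxy => f1 x hx y hy ⟨hxy, hx, hy⟩, f2⟩
  refine k4free_color (G := resG G U) (U := U) ?_ ?_ ?_ ?_ (fun x y h => h.2.1)
  · rintro a b c d e ⟨h1, ha, hb⟩ ⟨h2, -, hc⟩ ⟨h3, -, hd⟩ ⟨h4, -, he⟩ k1 k2 k3 k4 k5 k6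
    exact hP a b c d e h1 h2 h3 h4 (up ha hc k1) (up ha hd k2) (up ha he k3) (up hb hd k4)
      (up hb he k5) (up hc he k6)
  · rintro a b c d e x ⟨⟨h1, ha, hb⟩, ⟨h2, -, hc⟩, ⟨h3, -, hd⟩, ⟨h4, -, he⟩, ⟨h5, -, -⟩,
      k1, k2, k3, k4, k5⟩ ⟨l1, hx, -⟩ ⟨l2, -, -⟩ ⟨l3, -, -⟩ l4 l5
    exact hT a b c d e x ⟨h1, h2, h3, h4, h5, up ha hc k1, up hb hd k2, up hc he k3, up hd ha k4,
      up he hb k5⟩ l1 l2 l3 (up hx hc l4) (up hx hd l5)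
  · rintro a b c d ⟨h1, ha, hb⟩ ⟨h2, -, hc⟩ ⟨h4, -, hd⟩ ⟨h5, -, -⟩ ⟨h6, -, -⟩ ⟨h7, -, -⟩
    have q3 : G.IsNClique 3 {b, c, d} := SimpleGraph.is3Clique_triple_iff.2 ⟨h5, h6, h7⟩
    have q4 : G.IsNClique 4 (insert a {b, c, d}) := q3.insert (by
      intro z hz
      simp only [Finset.mem_insert, Finset.mem_singleton] at hz
      rcases hz with rfl | rfl | rfl <;> assumption)
    have := h3 _ (by
      intro z hz
      simp only [Finset.coe_insert, Finset.coe_singleton, Set.mem_insert_iff,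
        Set.mem_singleton_iff] at hz
      rcases hz with rfl | rfl | rfl | rfl <;> assumption) q4.1
    have := q4.2
    omega
  · intro a ha b hb
    refine (Rch.inv (hU a ha b hb) (fun z => Rch (resG G U) U a z) ?_
      Relation.ReflTransGen.refl)
    intro p hp q hq hpq hap
    exact hap.trans (rch_adj hp hq ⟨hpq, hp, hq⟩)

/-- A (P₅, HVN)-free graph containing an induced Y-5-wheel but no induced T-5-wheel
satisfies χ(G) ≤ ω(G) + 3. -/
theorem chi_le_omega_add_three_of_y5wheel {V : Type*} [Fintype V] (G : SimpleGraph V)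
    (hP5 : InducedFree G (pathGraph 5)) (hHVN : InducedFree G hvnGraph)
    (hY5 : ContainsInduced G y5WheelGraph) (hT5 : InducedFree G t5WheelGraph) :
    G.chromaticNumber ≤ (G.cliqueNum + 3 : ℕ) := by
  classical
  have p5 := p5f_of_free hP5
  have hv := hvnf_of_free hHVN
  have t5 := t5f_of_free hT5
  have hom : 3 ≤ G.cliqueNum := by
    obtain ⟨f, hf⟩ := hY5
    have h1 : G.Adj (f 0) (f 1) := (hf 0 1).1 (by simp [y5WheelGraph])
    have h2 : G.Adj (f 0) (f 5) := (hf 0 5).1 (by simp [y5WheelGraph])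
    have h3 : G.Adj (f 1) (f 5) := (hf 1 5).1 (by simp [y5WheelGraph])
    have q3 : G.IsNClique 3 {f 0, f 1, f 5} := SimpleGraph.is3Clique_triple_iff.2 ⟨h1, h2, h3⟩
    have := q3.1.card_le_cliqueNum
    have := q3.2
    omega
  obtain ⟨f, f1, f2⟩ := comp_color (G := G) Set.univ (fun _ k => k < G.cliqueNum + 3) (by
    intro x hx
    have hc : Conn G (cmpt G Set.univ x) := conn_cmpt hx
    obtain ⟨q, q1, q2, q3⟩ := exists_maxClique (G := G) (cmpt G Set.univ x)
    have hle := q2.card_le_cliqueNum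
    by_cases h4 : 4 ≤ q.card
    · obtain ⟨f, f1, f2⟩ := Big.color (G := G) ⟨p5, hv, hc, q1, q2, q3, h4⟩
      refine ⟨f, f1, fun y hy => ?_⟩
      have := f2 y hy
      show f y < G.cliqueNum + 3
      omega
    · obtain ⟨f, f1, f2⟩ := small_color p5 t5 hc (fun r hr hr2 => by
        have := q3 r hr hr2
        omega)
      refine ⟨f, f1, fun y hy => ?_⟩
      have := f2 y hy
      show f y < G.cliqueNum + 3
      omega)
  have hcol : G.Colorable (G.cliqueNum + 3) :=
    ⟨SimpleGraph.Coloring.mk (fun v => (⟨f v, f2 v (Set.mem_univ v)⟩ : Fin (G.cliqueNum + 3)))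
      (fun {v w} hvw h => f1 v (Set.mem_univ v) w (Set.mem_univ w) hvw (by
        simpa using h))⟩
  exact hcol.chromaticNumber_le
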